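/- arXiv:1710.00243 — 2 statements merged into one kernel-verified Lean document; each statement's English description precedes it below -/
import Mathlib

section
/- Let R be an NC-smooth ℂ-algebra such that R^{ab} is connected with Krull dimension ≥ 2. Then the natural map R^* → lim_d InnAut(R/I_{d+2}R), sending a unit of R to the compatible system of inner automorphisms of the quotients R/I_{d+2}R determined by its images, is surjective. Consequently, any automorphism of R inducing an inner automorphism of R/I_{d+2}R for every d is itself inner. -/
noncomputable section

open scoped BigOperators

namespace NCGeom

variable (R : Type) [Ring R] [Algebra ℂ R]

/-- `lieLCS R n` is the `(n+1)`-st term `R_{n+1}^{Lie}` of the lower central series of `R`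
viewed as a Lie algebra under `[a,b] = a*b - b*a`; so `lieLCS R 0 = R` and
`lieLCS R n = [R, lieLCS R (n-1)]`. -/
def lieLCS : ℕ → Submodule ℂ R
  | 0 => ⊤
  | n + 1 => Submodule.span ℂ {x : R | ∃ a ∈ lieLCS n, ∃ b : R, x = a * b - b * a}

/-- The set of products `r₀ · a₁ · r₁ · … · aₘ · rₘ` where `aₖ ∈ R_{iₖ}^{Lie}`, `iₖ ≥ 2` and
`i₁ + … + iₘ ≥ n`. -/
def commSet (n : ℕ) : Set R :=
  {x : R | ∃ (m : ℕ) (i : Fin m → ℕ) (r : Fin (m + 1) → R) (a : Fin m → R),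
    (∀ k, 2 ≤ i k) ∧ (n ≤ ∑ k, i k) ∧ (∀ k, a k ∈ lieLCS R (i k - 1)) ∧
    x = r 0 * (List.ofFn fun k : Fin m => a k * r k.succ).prod}

/-- The commutator filtration
`I_n R = Σ_{i₁,…,iₘ ≥ 2, i₁+…+iₘ ≥ n} R·R_{i₁}^{Lie}·R·…·R·R_{iₘ}^{Lie}·R`
(the two-sided ideal spanned by the corresponding products). -/
def commFiltration (n : ℕ) : TwoSidedIdeal R := TwoSidedIdeal.span (commSet R n)

/-- `R` is NC-nilpotent of degree `d` if `I_{d+2} R = 0`. -/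
def IsNCNilpotentOfDegree (d : ℕ) : Prop := ∀ x ∈ commFiltration R (d + 2), x = 0

/-- `R` is NC-nilpotent if it is NC-nilpotent of some degree, i.e. belongs to `𝒩`. -/
def IsNCNilpotent : Prop := ∃ d, IsNCNilpotentOfDegree R d

variable {R}

/-- A surjection `π : R → S` onto a commutative algebra exhibits `S` as the abelianization
`R^{ab} = R/I₂R` of `R` if its kernel is exactly `I₂R`. -/
def IsAbelianization {S : Type} [CommRing S] [Algebra ℂ S] (π : R →ₐ[ℂ] S) : Prop :=
  Function.Surjective π ∧ ∀ x : R, π x = 0 ↔ x ∈ commFiltration R 2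

/-- A central extension `0 → I → Λ' → Λ → 0` in `𝒩`: a surjection whose kernel `I` is a
central ideal with `I² = 0`. -/
structure IsCentralExtension {Λ' Λ : Type} [Ring Λ'] [Algebra ℂ Λ'] [Ring Λ] [Algebra ℂ Λ]
    (p : Λ' →ₐ[ℂ] Λ) : Prop where
  surjective : Function.Surjective p
  central : ∀ x : Λ', p x = 0 → ∀ y : Λ', x * y = y * x
  sq_zero : ∀ x y : Λ', p x = 0 → p y = 0 → x * y = 0

variable (R) in
/-- An NC-nilpotent algebra `A` of degree `d` is `d`-smooth if for every central extension
`B' → B` in `𝒩_d`, every homomorphism `A → B` lifts to `A → B'`. -/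
def IsdSmooth (d : ℕ) : Prop :=
  IsNCNilpotentOfDegree R d ∧
  ∀ (Λ' Λ : Type) (_ : Ring Λ') (_ : Algebra ℂ Λ') (_ : Ring Λ) (_ : Algebra ℂ Λ),
    IsNCNilpotentOfDegree Λ' d → IsNCNilpotentOfDegree Λ d →
    ∀ p : Λ' →ₐ[ℂ] Λ, IsCentralExtension p →
      ∀ f : R →ₐ[ℂ] Λ, ∃ g : R →ₐ[ℂ] Λ', p.comp g = f

variable (R) in
/-- `R` is NC-complete: complete and separated with respect to the commutator filtration. -/
def IsNCComplete : Prop :=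
  (∀ x : R, (∀ n, x ∈ commFiltration R n) → x = 0) ∧
  (∀ x : ℕ → R, (∀ n, x (n + 1) - x n ∈ commFiltration R n) →
    ∃ y : R, ∀ n, y - x n ∈ commFiltration R n)

variable (R) in
/-- `R` is NC-smooth: NC-complete, and homomorphisms from `R` to NC-nilpotent algebras lift
along all central extensions in `𝒩`. -/
def IsNCSmooth : Prop :=
  IsNCComplete R ∧
  ∀ (Λ' Λ : Type) (_ : Ring Λ') (_ : Algebra ℂ Λ') (_ : Ring Λ) (_ : Algebra ℂ Λ),
    IsNCNilpotent Λ' → IsNCNilpotent Λ →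
    ∀ p : Λ' →ₐ[ℂ] Λ, IsCentralExtension p →
      ∀ f : R →ₐ[ℂ] Λ, ∃ g : R →ₐ[ℂ] Λ', p.comp g = f

/-- Two algebra homomorphisms `f, g : A → B` are conjugate (equal in the category `a𝒩`)
if `g = u f u⁻¹` for a unit `u ∈ B`. -/
def Conjugate {A B : Type} [Ring A] [Algebra ℂ A] [Ring B] [Algebra ℂ B]
    (f g : A →ₐ[ℂ] B) : Prop :=
  ∃ u : Bˣ, ∀ a : A, g a = ↑u * f a * ↑u⁻¹

end NCGeom

namespace NCGeom

/-- A decreasing multiplicative filtration of a ring by additive subgroups for which all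
commutators have weight two, and taking a commutator raises the weight by one. -/
structure IsCommFiltration {B : Type} [Ring B] (P : ℕ → AddSubgroup B) : Prop where
  mem_zero : ∀ x, x ∈ P 0
  anti : ∀ {m n}, m ≤ n → P n ≤ P m
  mul_mem : ∀ {m n x y}, x ∈ P m → y ∈ P n → x * y ∈ P (m + n)
  comm_mem : ∀ {n x}, x ∈ P n → ∀ y, x * y - y * x ∈ P (n + 1)
  comm_mem_two : ∀ x y, x * y - y * x ∈ P 2

namespace IsCommFiltration

variable {B : Type} [Ring B] {P : ℕ → AddSubgroup B} (hP : IsCommFiltration P)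

include hP in
lemma mul_mem_left (x : B) {n : ℕ} {y : B} (hy : y ∈ P n) : x * y ∈ P n := by
  simpa using hP.mul_mem (hP.mem_zero x) hy

include hP in
lemma mul_mem_right {n : ℕ} {x : B} (hx : x ∈ P n) (y : B) : x * y ∈ P n := by
  simpa using hP.mul_mem hx (hP.mem_zero y)

variable [Algebra ℂ B]

include hP in
lemma lieLCS_le (i : ℕ) {a : B} (ha : a ∈ lieLCS B (i + 1)) : a ∈ P (i + 2) := by
  have key : ∀ (i : ℕ) (S : Set B), S ⊆ P i → ∀ a ∈ Submodule.span ℂ S, a ∈ P i := by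
    intro i S hS a ha
    induction ha using Submodule.span_induction with
    | mem x h => exact hS h
    | zero => exact zero_mem _
    | add x y _ _ hx hy => exact add_mem hx hy
    | smul c x _ hx =>
      rw [Algebra.smul_def]
      exact hP.mul_mem_left _ hx
  induction i generalizing a with
  | zero =>
    refine key _ _ ?_ _ ha
    rintro _ ⟨a, -, b, rfl⟩
    exact hP.comm_mem_two a b
  | succ i ih =>
    refine key _ _ ?_ _ ha
    rintro _ ⟨a, ha, b, rfl⟩
    exact hP.comm_mem (ih ha) b

end IsCommFiltration

variable (B : Type) [Ring B] [Algebra ℂ B]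

/-- The products of total weight exactly `n` generating the commutator filtration. -/
inductive CommProd : ℕ → B → Prop
  | base (r : B) : CommProd 0 r
  | cons (r : B) {i n : ℕ} {a y : B} (ha : a ∈ lieLCS B (i + 1)) (hy : CommProd n y) :
      CommProd (i + 2 + n) (r * a * y)

variable {B}

lemma CommProd.mul {m n : ℕ} {x y : B} (hx : CommProd B m x) (hy : CommProd B n y) :
    CommProd B (m + n) (x * y) := by
  induction hx with
  | base r =>
    cases hy with
    | base s => exact .base _
    | cons s ha hy =>
      rw [zero_add, ← mul_assoc, ← mul_assoc]
      exact .cons _ ha hy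
  | cons r ha _ ih =>
    rw [mul_assoc, add_assoc]
    exact .cons r ha ih

lemma exists_commProd_of_mem_commSet {n : ℕ} {x : B} (hx : x ∈ commSet B n) :
    ∃ N, n ≤ N ∧ CommProd B N x := by
  obtain ⟨m, i, r, a, hi, hn, ha, rfl⟩ := hx
  refine ⟨∑ k, i k, hn, ?_⟩
  clear hn
  induction m with
  | zero => simpa using CommProd.base (r 0)
  | succ m ih =>
    rw [Fin.sum_univ_succ, List.ofFn_succ, List.prod_cons, ← mul_assoc, ← mul_assoc,
      mul_assoc (r 0 * a 0)]
    obtain ⟨j, hj⟩ := Nat.exists_eq_add_of_le (hi 0)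
    have h0 := ha 0
    rw [hj, show 2 + j - 1 = j + 1 by omega] at h0
    rw [hj, add_comm 2 j]
    exact .cons _ h0 (ih (fun k => i k.succ) (fun k => r k.succ) (fun k => a k.succ)
      (fun k => hi _) (fun k => ha _))

lemma CommProd.mem_commSet {n : ℕ} {x : B} (hx : CommProd B n x) : x ∈ commSet B n := by
  induction hx with
  | base r => exact ⟨0, fun _ => 0, fun _ => r, fun _ => 0, by simp⟩
  | @cons r i n a y ha _ ih =>
    obtain ⟨m, j, s, b, hj, hn, hb, rfl⟩ := ih
    refine ⟨m + 1, Fin.cons (i + 2) j, Fin.cons r s, Fin.cons a b, ?_, ?_, ?_, ?_⟩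
    · intro k
      refine Fin.cases ?_ (fun k => ?_) k
      · simp
      · simpa using hj k
    · simpa [Fin.sum_univ_succ] using hn
    · intro k
      refine Fin.cases ?_ (fun k => ?_) k
      · simpa using ha
      · simpa using hb k
    · simp [List.ofFn_succ, mul_assoc]

lemma CommProd.mem {n : ℕ} {x : B} (hx : CommProd B n x) : x ∈ commFiltration B n :=
  TwoSidedIdeal.subset_span hx.mem_commSet

lemma commFiltration_anti {m n : ℕ} (h : m ≤ n) : commFiltration B n ≤ commFiltration B m := by
  refine TwoSidedIdeal.span_mono ?_
  rintro _ ⟨k, i, r, a, hi, hn, ha, rfl⟩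
  exact ⟨k, i, r, a, hi, h.trans hn, ha, rfl⟩

/-- The commutator filtration is additively spanned by the products `CommProd`. -/
lemma commFiltration_induction {n : ℕ} {p : ∀ x, x ∈ commFiltration B n → Prop}
    (prod : ∀ N x (hN : n ≤ N) (hx : CommProd B N x), p x (commFiltration_anti hN hx.mem))
    (zero : p 0 (zero_mem _))
    (add : ∀ x y hx hy, p x hx → p y hy → p (x + y) (add_mem hx hy))
    (neg : ∀ x hx, p x hx → p (-x) (neg_mem hx))
    {x : B} (hx : x ∈ commFiltration B n) : p x hx := by
  suffices h : ∀ x ∈ commFiltration B n,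
      x ∈ AddSubgroup.closure {x | ∃ N, n ≤ N ∧ CommProd B N x} by
    have h1 : ∀ x ∈ AddSubgroup.closure {x | ∃ N, n ≤ N ∧ CommProd B N x},
        ∃ hx : x ∈ commFiltration B n, p x hx := by
      intro x hx
      induction hx using AddSubgroup.closure_induction with
      | mem x h =>
        obtain ⟨N, hN, hx⟩ := h
        exact ⟨commFiltration_anti hN hx.mem, prod N x hN hx⟩
      | zero => exact ⟨zero_mem _, zero⟩
      | add x y _ _ hx hy => exact ⟨add_mem hx.1 hy.1, add x y hx.1 hy.1 hx.2 hy.2⟩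
      | neg x _ hx => exact ⟨neg_mem hx.1, neg x hx.1 hx.2⟩
    exact (h1 x (h x hx)).2
  intro x hx
  rw [commFiltration, TwoSidedIdeal.mem_span_iff_mem_addSubgroup_closure] at hx
  refine AddSubgroup.closure_mono ?_ hx
  rintro _ ⟨_, ⟨r, -, a, ha, rfl⟩, s, -, rfl⟩
  obtain ⟨N, hN, ha⟩ := exists_commProd_of_mem_commSet ha
  exact ⟨N, hN, by simpa using ((CommProd.base r).mul ha).mul (CommProd.base s)⟩

/-- The commutator filtration is the smallest filtration by commutators. -/
lemma IsCommFiltration.mem_of_mem_commFiltration {P : ℕ → AddSubgroup B}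
    (hP : IsCommFiltration P) {n : ℕ} {x : B} (hx : x ∈ commFiltration B n) : x ∈ P n := by
  induction hx using commFiltration_induction with
  | prod N x hN hx =>
    refine hP.anti hN ?_
    clear hN
    induction hx with
    | base r => exact hP.mem_zero r
    | cons r ha _ ih => exact hP.mul_mem (hP.mul_mem_left r (hP.lieLCS_le _ ha)) ih
  | zero => exact zero_mem _
  | add x y _ _ hx hy => exact add_mem hx hy
  | neg x _ hx => exact neg_mem hx

variable (B) in
/-- The terms of the commutator filtration as additive subgroups. -/
def commFil (n : ℕ) : AddSubgroup B := (commFiltration B n).asIdeal.toAddSubgroup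

lemma commFiltration_mul_mem {m n : ℕ} {x y : B} (hx : x ∈ commFiltration B m)
    (hy : y ∈ commFiltration B n) : x * y ∈ commFiltration B (m + n) := by
  induction hx using commFiltration_induction with
  | prod M x hM hx =>
    induction hy using commFiltration_induction with
    | prod N y hN hy => exact commFiltration_anti (add_le_add hM hN) (hx.mul hy).mem
    | zero => rw [mul_zero]; exact zero_mem _
    | add y z _ _ hy hz => rw [mul_add]; exact add_mem hy hz
    | neg y _ hy => rw [mul_neg]; exact neg_mem hy
  | zero => rw [zero_mul]; exact zero_mem _
  | add x z _ _ hx hz => rw [add_mul]; exact add_mem hx hz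
  | neg y _ hy => rw [neg_mul]; exact neg_mem hy

lemma mem_commFiltration_zero (x : B) : x ∈ commFiltration B 0 := (CommProd.base x).mem

lemma lieLCS_le_commFiltration {i : ℕ} {a : B} (ha : a ∈ lieLCS B (i + 1)) :
    a ∈ commFiltration B (i + 2) := by
  simpa using (CommProd.cons 1 ha (CommProd.base 1)).mem

lemma comm_mem_lieLCS {i : ℕ} {a : B} (ha : a ∈ lieLCS B i) (b : B) :
    a * b - b * a ∈ lieLCS B (i + 1) :=
  Submodule.subset_span ⟨a, ha, b, rfl⟩

variable (B) in
lemma isCommFiltration_commFil : IsCommFiltration (commFil B) where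
  mem_zero := mem_commFiltration_zero
  anti := commFiltration_anti
  mul_mem := commFiltration_mul_mem
  comm_mem_two x y :=
    lieLCS_le_commFiltration (comm_mem_lieLCS (i := 0) (by simp [lieLCS]) y)
  comm_mem {n x} hx b := by
    have h2 : ∀ x y : B, x * y - y * x ∈ commFiltration B 2 := fun x y =>
      lieLCS_le_commFiltration (comm_mem_lieLCS (i := 0) (by simp [lieLCS]) y)
    change _ ∈ commFiltration B _
    replace hx : x ∈ commFiltration B n := hx
    induction hx using commFiltration_induction with
    | prod N x hN hx =>
      refine commFiltration_anti (Nat.succ_le_succ hN) ?_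
      clear hN
      induction hx with
      | base r => exact commFiltration_anti (by omega) (h2 r b)
      | @cons r i n a y ha hy ih =>
        have e : r * a * y * b - b * (r * a * y) = (r * b - b * r) * a * y
            + r * (a * b - b * a) * y + r * a * (y * b - b * y) := by noncomm_ring
        rw [e]
        have hai := lieLCS_le_commFiltration ha
        refine add_mem (add_mem ?_ ?_) ?_
        · exact commFiltration_anti (by omega)
            (commFiltration_mul_mem (commFiltration_mul_mem (h2 r b) hai) hy.mem)
        · exact commFiltration_anti (by omega) (commFiltration_mul_mem (commFiltration_mul_mem
            (mem_commFiltration_zero r) (lieLCS_le_commFiltration (comm_mem_lieLCS ha b))) hy.mem)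
        · exact commFiltration_anti (by omega) (commFiltration_mul_mem (commFiltration_mul_mem
            (mem_commFiltration_zero r) hai) ih)
    | zero => simp
    | add x y _ _ hx hy =>
      rw [add_mul, mul_add, add_sub_add_comm]
      exact add_mem hx hy
    | neg x _ hx =>
      rw [show -x * b - b * -x = -(x * b - b * x) by noncomm_ring]
      exact neg_mem hx

end NCGeom

namespace NCGeom

lemma eq_zero_of_mem_commFiltration_two {C : Type} [CommRing C] [Algebra ℂ C] {x : C}
    (hx : x ∈ commFiltration C 2) : x = 0 := by
  have hP : IsCommFiltration (B := C) (fun n => if n = 0 then ⊤ else ⊥) :=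
    { mem_zero := fun x => by simp
      anti := fun {m n} h => by
        by_cases hm : m = 0
        · simp [hm]
        · simp [hm, show n ≠ 0 by omega]
      mul_mem := fun {m n x y} hx hy => by
        by_cases hm : m = 0 <;> by_cases hn : n = 0 <;> simp_all
      comm_mem := fun {n x} _ y => by simp [mul_comm x y]
      comm_mem_two := fun x y => by simp [mul_comm x y] }
  simpa using hP.mem_of_mem_commFiltration hx

lemma isNCNilpotent_of_commRing (C : Type) [CommRing C] [Algebra ℂ C] : IsNCNilpotent C :=
  ⟨0, fun _ => eq_zero_of_mem_commFiltration_two⟩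

lemma map_mem_commFiltration {A B : Type} [Ring A] [Algebra ℂ A] [Ring B] [Algebra ℂ B]
    (f : A →ₐ[ℂ] B) {n : ℕ} {x : A} (hx : x ∈ commFiltration A n) : f x ∈ commFiltration B n := by
  have hB := isCommFiltration_commFil B
  have hP : IsCommFiltration (fun n => (commFil B n).comap (f : A →+ B)) :=
    { mem_zero := fun x => hB.mem_zero _
      anti := fun h x hx => hB.anti h hx
      mul_mem := fun {m n x y} hx hy => by
        simpa using hB.mul_mem (AddSubgroup.mem_comap.1 hx) (AddSubgroup.mem_comap.1 hy)
      comm_mem := fun {n x} hx y => by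
        simpa using hB.comm_mem (AddSubgroup.mem_comap.1 hx) (f y)
      comm_mem_two := fun x y => by simpa using hB.comm_mem_two (f x) (f y) }
  exact hP.mem_of_mem_commFiltration hx

section Smooth

variable {R : Type} [Ring R] [Algebra ℂ R] {S : Type} [CommRing S] [Algebra ℂ S]
  {π : R →ₐ[ℂ] S}

/-- The abelianization of an NC-smooth algebra is formally smooth. -/
lemma IsNCSmooth.formallySmooth (hsm : IsNCSmooth R) (hπ : IsAbelianization π) :
    Algebra.FormallySmooth ℂ S := by
  refine Algebra.FormallySmooth.of_comp_surjective fun C _ _ I hI f => ?_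
  have hp : IsCentralExtension (Ideal.Quotient.mkₐ ℂ I) :=
    { surjective := Ideal.Quotient.mkₐ_surjective ℂ I
      central := fun x _ y => mul_comm x y
      sq_zero := fun x y hx hy => by
        have hx' : x ∈ I := Ideal.Quotient.eq_zero_iff_mem.1 hx
        have hy' : y ∈ I := Ideal.Quotient.eq_zero_iff_mem.1 hy
        have := Ideal.mul_mem_mul hx' hy'
        rwa [← pow_two, hI] at this }
  obtain ⟨g, hg⟩ := hsm.2 _ _ _ _ _ _ (isNCNilpotent_of_commRing C)
    (isNCNilpotent_of_commRing (C ⧸ I)) _ hp (f.comp π)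
  have hker : ∀ x ∈ RingHom.ker π, g x = 0 := fun x hx =>
    eq_zero_of_mem_commFiltration_two (map_mem_commFiltration g ((hπ.2 x).1 hx))
  let e := Ideal.quotientKerAlgEquivOfSurjective hπ.1
  refine ⟨(Ideal.Quotient.liftₐ (RingHom.ker π) g hker).comp e.symm.toAlgHom,
    AlgHom.ext fun s => ?_⟩
  obtain ⟨r, rfl⟩ := hπ.1 s
  have he : e.symm (π r) = Ideal.Quotient.mk (RingHom.ker π) r := by
    rw [AlgEquiv.symm_apply_eq]
    rfl
  change Ideal.Quotient.mk I (Ideal.Quotient.lift (RingHom.ker π) g.toRingHom hker (e.symm (π r))) = _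
  rw [he]
  exact DFunLike.congr_fun hg r

end Smooth

variable {S : Type} [CommRing S] [Algebra ℂ S]

open scoped KaehlerDifferential in
/-- Étale coordinates near a point of `Spec S`. -/
structure LocalCoords (p : Ideal S) [p.IsPrime] (k : ℕ) where
  x : Fin k → S
  d : Fin k → Derivation ℂ S (Localization.AtPrime p)
  d_x : ∀ i j, d i (x j) = if i = j then 1 else 0
  exists_smul_eq : ∀ b : S, ∃ h ∉ p, ∃ c : Fin k → S,
    h • KaehlerDifferential.D ℂ S b = ∑ i, c i • KaehlerDifferential.D ℂ S (x i)

open scoped KaehlerDifferential in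
lemma exists_localCoords [Algebra.FiniteType ℂ S] [Algebra.FormallySmooth ℂ S]
    (p : PrimeSpectrum S) :
    Nonempty (LocalCoords p.asIdeal (Module.rankAtStalk (R := S) (Ω[S⁄ℂ]) p)) := by
  have : IsNoetherianRing S := Algebra.FiniteType.isNoetherianRing ℂ S
  let A := Localization.AtPrime p.asIdeal
  let M := p.asIdeal.primeCompl
  let Ωp := LocalizedModule M (Ω[S⁄ℂ])
  let mk := LocalizedModule.mkLinearMap M (Ω[S⁄ℂ])
  let v : S → Ωp := fun s => mk (KaehlerDifferential.D ℂ S s)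
  have hv : Submodule.span A (Set.range v) = ⊤ := by
    have := span_eq_top_of_isLocalizedModule A M mk
      (KaehlerDifferential.span_range_derivation ℂ S)
    rwa [← Set.range_comp] at this
  obtain ⟨κ, a, b, hb⟩ := Module.exists_basis_of_span_of_flat v hv
  have : Finite κ := Module.Finite.finite_basis b
  have hk : Module.finrank A Ωp = Nat.card κ := Module.finrank_eq_nat_card_basis b
  let e : κ ≃ Fin (Module.rankAtStalk (R := S) (Ω[S⁄ℂ]) p) := Finite.equivFinOfCardEq hk.symm
  let b' := b.reindex e
  have hb' : ∀ i, b' i = mk (KaehlerDifferential.D ℂ S (a (e.symm i))) := fun i => by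
    simp [b', hb, v]
  refine ⟨⟨fun i => a (e.symm i),
    fun i => (((b'.coord i).restrictScalars S).comp mk).compDer (KaehlerDifferential.D ℂ S),
    fun i j => ?_, fun f => ?_⟩⟩
  · change b'.coord i (mk (KaehlerDifferential.D ℂ S (a (e.symm j)))) = _
    rw [← hb', Module.Basis.coord_apply, b'.repr_self, Finsupp.single_apply]
    simp only [eq_comm]
  · obtain ⟨s, hs⟩ := IsLocalization.exist_integer_multiples_of_finite M
      (fun i => b'.repr (v f) i)
    choose c hc using hs
    have h1 : mk (s.1 • KaehlerDifferential.D ℂ S f) =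
        mk (∑ i, c i • KaehlerDifferential.D ℂ S (a (e.symm i))) := by
      rw [map_smul, map_sum]
      simp only [map_smul, ← hb']
      change s.1 • v f = _
      conv_lhs => rw [← b'.sum_repr (v f)]
      rw [Finset.smul_sum]
      refine Finset.sum_congr rfl fun i _ => ?_
      rw [← smul_assoc]
      have := hc i
      rw [← algebraMap_smul A (c i) (b' i), this]
    obtain ⟨t, ht⟩ := (IsLocalizedModule.eq_iff_exists M mk).1 h1
    refine ⟨t.1 * s.1, (t * s).2, fun i => t.1 * c i, ?_⟩
    simpa [Submonoid.smul_def, Finset.smul_sum, mul_smul] using ht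

end NCGeom

namespace NCGeom

variable {S : Type} [CommRing S] [Algebra ℂ S]

lemma exists_point [Algebra.FiniteType ℂ S] (p : Ideal S) [hp : p.IsMaximal] :
    ∃ ε : S →ₐ[ℂ] ℂ, ∀ s, ε s = 0 ↔ s ∈ p := by
  let := Ideal.Quotient.field p
  have := finite_of_finite_type_of_isJacobsonRing ℂ (S ⧸ p)
  let e : ℂ ≃ₐ[ℂ] (S ⧸ p) := AlgEquiv.ofBijective (Algebra.ofId ℂ (S ⧸ p))
    (IsAlgClosed.algebraMap_bijective_of_isIntegral (k := ℂ) (K := S ⧸ p))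
  refine ⟨(e.symm : (S ⧸ p) →ₐ[ℂ] ℂ).comp (Ideal.Quotient.mkₐ ℂ p), fun s => ?_⟩
  simp [Ideal.Quotient.eq_zero_iff_mem]

namespace LocalCoords

variable {p : Ideal S} [p.IsPrime] {k : ℕ} (C : LocalCoords p k) (ε : S →ₐ[ℂ] ℂ)

/-- The derivation `a ↦ a - a(p)` with values in `S / p²`. -/
def toCotangent (hε : ∀ s, ε s = 0 ↔ s ∈ p) : Derivation ℂ S (S ⧸ p ^ 2) :=
  Derivation.mk' ((Ideal.Quotient.mkₐ ℂ (p ^ 2)).toLinearMap ∘ₗ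
    (LinearMap.id - (Algebra.linearMap ℂ S) ∘ₗ ε.toLinearMap)) fun a b => by
    have h : ∀ a, a - algebraMap ℂ S (ε a) ∈ p := fun a => by simp [← hε]
    have h2 := Ideal.mul_mem_mul (h a) (h b)
    rw [← pow_two, ← Ideal.Quotient.eq_zero_iff_mem] at h2
    change Ideal.Quotient.mk (p ^ 2) _ =
      Ideal.Quotient.mk (p ^ 2) (a * (b - algebraMap ℂ S (ε b))) +
      Ideal.Quotient.mk (p ^ 2) (b * (a - algebraMap ℂ S (ε a)))
    rw [← sub_eq_zero, ← map_add, ← map_sub, ← neg_eq_zero, ← map_neg, ← h2]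
    congr 1
    simp
    ring

lemma smul_sub_sum_mem (hε : ∀ s, ε s = 0 ↔ s ∈ p) {b h : S} {c : Fin k → S}
    (H : h • KaehlerDifferential.D ℂ S b = ∑ i, c i • KaehlerDifferential.D ℂ S (C.x i)) :
    h * (b - algebraMap ℂ S (ε b)) - ∑ i, c i * (C.x i - algebraMap ℂ S (ε (C.x i))) ∈ p ^ 2 := by
  have := congrArg (toCotangent ε hε).liftKaehlerDifferential H
  simp only [map_smul, map_sum, Derivation.liftKaehlerDifferential_comp_D] at this
  rw [← Ideal.Quotient.eq_zero_iff_mem, map_sub, map_sum, sub_eq_zero]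
  exact this

lemma smul_d_eq {b h : S} {c : Fin k → S}
    (H : h • KaehlerDifferential.D ℂ S b = ∑ i, c i • KaehlerDifferential.D ℂ S (C.x i))
    (i : Fin k) : algebraMap S (Localization.AtPrime p) h * C.d i b = algebraMap S _ (c i) := by
  have := congrArg (C.d i).liftKaehlerDifferential H
  simp only [map_smul, map_sum, Derivation.liftKaehlerDifferential_comp_D, C.d_x] at this
  simpa [Algebra.smul_def] using this

/-- A function whose partial derivatives near `p` vanish has a differential vanishing near `p`. -/
lemma exists_smul_D_eq_zero {f : S} (hf : ∀ i, C.d i f = 0) :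
    ∃ h ∉ p, h • KaehlerDifferential.D ℂ S f = 0 := by
  obtain ⟨h, hh, c, hc⟩ := C.exists_smul_eq f
  have h0 : ∀ i, ∃ t : p.primeCompl, t * c i = 0 := fun i => by
    have := C.smul_d_eq hc i
    rw [hf, mul_zero, eq_comm] at this
    rwa [IsLocalization.map_eq_zero_iff p.primeCompl] at this
  choose t ht using h0
  refine ⟨(∏ i, t i : p.primeCompl) * h, ((∏ i, t i) * (⟨h, hh⟩ : p.primeCompl)).2, ?_⟩
  rw [mul_smul, hc, Finset.smul_sum]
  refine Finset.sum_eq_zero fun i _ => ?_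
  obtain ⟨u, hu⟩ := Finset.dvd_prod_of_mem t (Finset.mem_univ i)
  rw [smul_smul, hu, Submonoid.coe_mul, mul_right_comm, ht, zero_mul, zero_smul]

include C in
lemma height_le [IsNoetherianRing S] (hε : ∀ s, ε s = 0 ↔ s ∈ p) : p.height ≤ k := by
  let A := Localization.AtPrime p
  let y : Fin k → A := fun i => algebraMap S A (C.x i - algebraMap ℂ S (ε (C.x i)))
  have hp2 : (p ^ 2).map (algebraMap S A) = IsLocalRing.maximalIdeal A ^ 2 := by
    rw [Ideal.map_pow, Localization.AtPrime.map_eq_maximalIdeal]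
  have hle : IsLocalRing.maximalIdeal A ≤ Ideal.span (Set.range y) := by
    refine Submodule.le_of_le_smul_of_le_jacobson_bot (IsNoetherian.noetherian _)
      (IsLocalRing.maximalIdeal_le_jacobson ⊥) ?_
    rw [← Localization.AtPrime.map_eq_maximalIdeal, Ideal.map_le_iff_le_comap]
    intro b hb
    obtain ⟨h, hh, c, hc⟩ := C.exists_smul_eq b
    have h1 := C.smul_sub_sum_mem ε hε hc
    rw [(hε b).2 hb, map_zero, sub_zero] at h1
    have h2 := Ideal.mem_map_of_mem (algebraMap S A) h1
    rw [Ideal.map_pow] at h2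
    have hu : IsUnit (algebraMap S A h) := IsLocalization.map_units A (⟨h, hh⟩ : p.primeCompl)
    rw [Ideal.mem_comap, ← Ideal.unit_mul_mem_iff_mem _ hu, ← map_mul]
    have h3 : h * b = ∑ i, c i * (C.x i - algebraMap ℂ S (ε (C.x i))) +
      (h * b - ∑ i, c i * (C.x i - algebraMap ℂ S (ε (C.x i)))) := by ring
    rw [h3, map_add]
    refine Submodule.add_mem_sup ?_ (by rwa [smul_eq_mul, ← pow_two])
    rw [map_sum]
    refine sum_mem fun i _ => ?_
    rw [map_mul]
    exact Ideal.mul_mem_left _ _ (Ideal.subset_span ⟨i, rfl⟩)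
  have hne : Ideal.span (Set.range y) ≠ ⊤ := by
    refine ne_top_of_le_ne_top (Ideal.IsPrime.ne_top (IsLocalRing.maximalIdeal.isMaximal A).isPrime) ?_
    rw [Ideal.span_le]
    rintro _ ⟨i, rfl⟩
    rw [← Localization.AtPrime.map_eq_maximalIdeal]
    exact Ideal.mem_map_of_mem _ ((hε _).1 (by simp))
  have hdim := ringKrullDim_le_spanFinrank_maximalIdeal A
  rw [IsLocalization.AtPrime.ringKrullDim_eq_height p A] at hdim
  have heq : IsLocalRing.maximalIdeal A = Ideal.span (Set.range y) :=
    (IsLocalRing.maximalIdeal.isMaximal A).eq_of_le hne hle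
  have hfin : (IsLocalRing.maximalIdeal A).spanFinrank ≤ k := by
    rw [heq]
    refine (Submodule.spanFinrank_span_le_ncard_of_finite (Set.finite_range y)).trans ?_
    rw [← Set.image_univ]
    exact (Set.ncard_image_le Set.finite_univ).trans (by simp [Set.ncard_univ])
  have h2 : (p.height : WithBot ℕ∞) ≤ (k : ℕ∞) := hdim.trans (by exact_mod_cast hfin)
  exact_mod_cast h2

/-- The Euler operator at `p`. -/
def euler : Derivation ℂ S (Localization.AtPrime p) :=
  ∑ i, (C.x i - algebraMap ℂ S (ε (C.x i))) • C.d i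

lemma euler_apply (f : S) :
    C.euler ε f = ∑ i, (C.x i - algebraMap ℂ S (ε (C.x i))) • C.d i f := by
  rw [euler, ← Derivation.coeFnAddMonoidHom_apply, map_sum, Finset.sum_apply]
  rfl

variable {ε}

omit [Algebra ℂ S] in
lemma algebraMap_mem_maximalIdeal_pow {n : ℕ} {f : S} (hf : f ∈ p ^ n) :
    algebraMap S (Localization.AtPrime p) f ∈
      IsLocalRing.maximalIdeal (Localization.AtPrime p) ^ n := by
  rw [← Localization.AtPrime.map_eq_maximalIdeal, ← Ideal.map_pow]
  exact Ideal.mem_map_of_mem _ hf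

lemma euler_mem (hε : ∀ s, ε s = 0 ↔ s ∈ p) (f : S) :
    C.euler ε f ∈ IsLocalRing.maximalIdeal (Localization.AtPrime p) := by
  rw [euler_apply]
  refine sum_mem fun i _ => ?_
  rw [Algebra.smul_def]
  refine Ideal.mul_mem_right _ _ ?_
  rw [← Localization.AtPrime.map_eq_maximalIdeal]
  exact Ideal.mem_map_of_mem _ ((hε _).1 (by simp))

lemma euler_sub_mem (hε : ∀ s, ε s = 0 ↔ s ∈ p) (n : ℕ) {f : S} (hf : f ∈ p ^ n) :
    C.euler ε f - n * algebraMap S (Localization.AtPrime p) f ∈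
      IsLocalRing.maximalIdeal (Localization.AtPrime p) ^ (n + 1) := by
  have h1 : ∀ f ∈ p, C.euler ε f - algebraMap S (Localization.AtPrime p) f ∈
      IsLocalRing.maximalIdeal (Localization.AtPrime p) ^ 2 := fun f hf => by
    obtain ⟨h, hh, c, hc⟩ := C.exists_smul_eq f
    have h2 := algebraMap_mem_maximalIdeal_pow (C.smul_sub_sum_mem ε hε hc)
    rw [(hε f).2 hf, map_zero, sub_zero] at h2
    have hu : IsUnit (algebraMap S (Localization.AtPrime p) h) :=
      IsLocalization.map_units _ (⟨h, hh⟩ : p.primeCompl)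
    rw [← Ideal.unit_mul_mem_iff_mem _ hu, ← neg_mem_iff]
    convert h2 using 1
    rw [euler_apply, mul_sub, Finset.mul_sum, map_sub, map_sum, map_mul, neg_sub]
    congr 1
    refine Finset.sum_congr rfl fun i _ => ?_
    rw [Algebra.smul_def, mul_left_comm, C.smul_d_eq hc, ← map_mul, mul_comm]
  induction n generalizing f with
  | zero => simpa using C.euler_mem hε f
  | succ n ih =>
    rw [pow_succ'] at hf
    induction hf using Submodule.mul_induction_on' with
    | mem_mul_mem a ha b hb =>
      have e : C.euler ε (a * b) - (n + 1 : ℕ) * algebraMap S (Localization.AtPrime p) (a * b) =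
          algebraMap S _ a * (C.euler ε b - n * algebraMap S _ b) +
          (C.euler ε a - algebraMap S _ a) * algebraMap S _ b := by
        rw [Derivation.leibniz, Algebra.smul_def, Algebra.smul_def, map_mul]
        push_cast
        ring
      rw [e]
      refine add_mem ?_ ?_
      · rw [pow_succ' _ (n + 1)]
        refine Ideal.mul_mem_mul ?_ (ih hb)
        rw [← Localization.AtPrime.map_eq_maximalIdeal]
        exact Ideal.mem_map_of_mem _ ha
      · rw [show n + 1 + 1 = 2 + n by omega, pow_add]
        exact Ideal.mul_mem_mul (h1 a ha) (algebraMap_mem_maximalIdeal_pow hb)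
    | add a _ b _ ha hb =>
      rw [map_add, map_add, mul_add, add_sub_add_comm]
      exact add_mem ha hb

/-- A function vanishing at `p` whose partial derivatives near `p` vanish is zero to infinite
order at `p`. -/
lemma mem_pow_of_d_eq_zero (hε : ∀ s, ε s = 0 ↔ s ∈ p) {f : S} (hf : ∀ i, C.d i f = 0)
    (hfp : f ∈ p) (n : ℕ) :
    algebraMap S (Localization.AtPrime p) f ∈
      IsLocalRing.maximalIdeal (Localization.AtPrime p) ^ (n + 1) := by
  induction n with
  | zero => exact algebraMap_mem_maximalIdeal_pow (by simpa using hfp)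
  | succ n ih =>
    rw [← Localization.AtPrime.map_eq_maximalIdeal, ← Ideal.map_pow,
      IsLocalization.algebraMap_mem_map_algebraMap_iff p.primeCompl] at ih
    obtain ⟨s, hs, hsf⟩ := ih
    have hu : IsUnit (algebraMap S (Localization.AtPrime p) s) :=
      IsLocalization.map_units _ (⟨s, hs⟩ : p.primeCompl)
    have h0 : C.euler ε f = 0 := by simp [euler_apply, hf]
    have h1 := C.euler_sub_mem hε (n + 1) hsf
    rw [Derivation.leibniz, h0, smul_zero, zero_add, Algebra.smul_def] at h1
    have h2 : algebraMap S (Localization.AtPrime p) f * C.euler ε s ∈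
        IsLocalRing.maximalIdeal (Localization.AtPrime p) ^ (n + 1 + 1) := by
      rw [pow_succ]
      refine Ideal.mul_mem_mul ?_ (C.euler_mem hε s)
      rw [← Localization.AtPrime.map_eq_maximalIdeal, ← Ideal.map_pow,
        IsLocalization.algebraMap_mem_map_algebraMap_iff p.primeCompl]
      exact ⟨s, hs, hsf⟩
    have h3 := sub_mem h2 h1
    rw [sub_sub_cancel, map_mul, ← mul_assoc] at h3
    refine (Ideal.unit_mul_mem_iff_mem _ (IsUnit.mul ?_ hu)).1 h3
    have : ((n + 1 : ℕ) : Localization.AtPrime p) = algebraMap ℂ _ (n + 1 : ℕ) := by simp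
    rw [this]
    exact (IsUnit.mk0 ((n + 1 : ℕ) : ℂ) (by exact_mod_cast n.succ_ne_zero)).map _

end LocalCoords

end NCGeom

namespace NCGeom

lemma eq_zero_or_one_of_isIdempotentElem {S : Type} [CommRing S]
    [PreconnectedSpace (PrimeSpectrum S)] {e : S} (he : IsIdempotentElem e) : e = 0 ∨ e = 1 := by
  have h : IsClopen (PrimeSpectrum.basicOpen e : Set (PrimeSpectrum S)) :=
    PrimeSpectrum.isClopen_iff.2 ⟨e, he, rfl⟩
  rcases isClopen_iff.1 h with h | h
  · left
    have h1 : PrimeSpectrum.basicOpen e = ⊥ := by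
      ext1
      exact h
    obtain ⟨n, hn⟩ := PrimeSpectrum.basicOpen_eq_bot_iff e |>.1 h1
    rcases n with _ | n
    · rw [← mul_one e, ← pow_zero e, hn, mul_zero]
    · rwa [he.pow_succ_eq] at hn
  · right
    have h1 : PrimeSpectrum.basicOpen e = ⊤ := by
      ext1
      exact h
    have hu : IsUnit e := by
      by_contra hu
      obtain ⟨m, hm, hem⟩ := exists_max_ideal_of_mem_nonunits hu
      have : (⟨m, hm.isPrime⟩ : PrimeSpectrum S) ∈ PrimeSpectrum.basicOpen e := by
        rw [h1]
        trivial
      exact this hem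
    exact hu.mul_left_cancel (by rw [he.eq, mul_one])

variable {S : Type} [CommRing S] [Algebra ℂ S] [Algebra.FiniteType ℂ S]
  [Algebra.FormallySmooth ℂ S] [ConnectedSpace (PrimeSpectrum S)]

/-- On a smooth connected variety the functions with zero differential are constant. -/
lemma exists_eq_algebraMap_of_D_eq_zero {f : S} (hf : KaehlerDifferential.D ℂ S f = 0) :
    ∃ c : ℂ, f = algebraMap ℂ S c := by
  have : IsNoetherianRing S := Algebra.FiniteType.isNoetherianRing ℂ S
  obtain ⟨p₀⟩ := ConnectedSpace.toNonempty (α := PrimeSpectrum S)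
  have : Nontrivial S := ⟨0, 1, fun h => p₀.2.ne_top ((Ideal.eq_top_iff_one _).2 (h ▸ zero_mem _))⟩
  obtain ⟨m, hm⟩ := Ideal.exists_maximal S
  obtain ⟨ε₀, hε₀⟩ := exists_point m
  refine ⟨ε₀ f, ?_⟩
  set g := f - algebraMap ℂ S (ε₀ f) with hg
  have hgm : g ∈ m := (hε₀ g).1 (by simp [hg])
  have hdg : KaehlerDifferential.D ℂ S g = 0 := by simp [hg, hf]
  have htop : Ideal.span {g} ⊔ Submodule.annihilator (Ideal.span {g}) = ⊤ := by
    by_contra hne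
    obtain ⟨p, hp, hle⟩ := Ideal.exists_le_maximal _ hne
    have hgp : g ∈ p := hle (Submodule.mem_sup_left (Ideal.mem_span_singleton_self g))
    obtain ⟨ε, hε⟩ := exists_point p
    obtain ⟨C⟩ := exists_localCoords (S := S) ⟨p, hp.isPrime⟩
    have hd : ∀ i, C.d i g = 0 := fun i => by
      rw [← Derivation.liftKaehlerDifferential_comp_D, hdg, map_zero]
    have h0 : algebraMap S (Localization.AtPrime p) g ∈
        ⨅ n : ℕ, IsLocalRing.maximalIdeal (Localization.AtPrime p) ^ n := by
      rw [Ideal.mem_iInf]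
      exact fun n => Ideal.pow_le_pow_right n.le_succ (C.mem_pow_of_d_eq_zero hε hd hgp n)
    rw [Ideal.iInf_pow_eq_bot_of_isLocalRing _ (IsLocalRing.maximalIdeal.isMaximal _).ne_top,
      Ideal.mem_bot, IsLocalization.map_eq_zero_iff p.primeCompl] at h0
    obtain ⟨s, hs⟩ := h0
    refine s.2 (hle (Submodule.mem_sup_right ?_))
    rw [Submodule.mem_annihilator_span_singleton]
    exact hs
  obtain ⟨a, ha, e, he, hae⟩ := Submodule.mem_sup.1 ((Ideal.eq_top_iff_one _).1 htop)
  obtain ⟨s, rfl⟩ := Ideal.mem_span_singleton'.1 ha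
  rw [Submodule.mem_annihilator_span_singleton, smul_eq_mul] at he
  have hid : IsIdempotentElem e := by
    have : e * (s * g + e) = e := by rw [hae, mul_one]
    rwa [mul_add, mul_left_comm, he, mul_zero, zero_add] at this
  rcases eq_zero_or_one_of_isIdempotentElem hid with rfl | rfl
  · rw [add_zero] at hae
    exact (hm.ne_top ((Ideal.eq_top_iff_one _).2 (hae ▸ Ideal.mul_mem_left _ _ hgm))).elim
  · rwa [one_mul, hg, sub_eq_zero] at he

open scoped KaehlerDifferential in
/-- On a connected smooth variety of dimension at least two there are at least two coordinates
near every point. -/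
lemma exists_localCoords_two_le (hdim : 2 ≤ ringKrullDim S) (p : Ideal S) [hp : p.IsPrime] :
    ∃ k, 2 ≤ k ∧ Nonempty (LocalCoords p k) := by
  have : IsNoetherianRing S := Algebra.FiniteType.isNoetherianRing ℂ S
  have : Nontrivial S := ⟨0, 1, fun h => hp.ne_top ((Ideal.eq_top_iff_one _).2 (h ▸ zero_mem _))⟩
  refine ⟨_, ?_, exists_localCoords ⟨p, hp⟩⟩
  obtain ⟨m, hm, h2⟩ : ∃ m : Ideal S, m.IsMaximal ∧ 2 ≤ m.height := by
    by_contra! h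
    have h1 : (⨆ (I : Ideal S) (_ : I.IsMaximal), I.height) ≤ 1 :=
      iSup₂_le fun I hI => Order.le_of_lt_add_one (h I hI)
    rw [← Ideal.sup_isMaximal_height_eq_ringKrullDim] at hdim
    have h3 : (2 : ℕ∞) ≤ 1 := (WithBot.coe_le_coe.1 hdim).trans h1
    exact absurd h3 (by norm_num)
  obtain ⟨ε, hε⟩ := exists_point m
  obtain ⟨C⟩ := exists_localCoords (S := S) ⟨m, hm.isPrime⟩
  have h3 := h2.trans (C.height_le ε hε)
  rw [(Module.isLocallyConstant_rankAtStalk (R := S) (M := Ω[S⁄ℂ])).apply_eq_of_preconnectedSpace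
    ⟨p, hp⟩ ⟨m, hm.isPrime⟩]
  exact_mod_cast h3

end NCGeom

namespace NCGeom

section FreeAlg

variable (A : Type) [CommRing A] (k : ℕ)

/-- The free algebra on `k` generators with central coefficients `A`. -/
abbrev FreeAlg : Type := MonoidAlgebra A (FreeMonoid (Fin k))

variable {A k}

lemma FreeAlg.coeff_mul_eq_zero {m n : ℕ} {f g : FreeAlg A k}
    (hf : ∀ w, w.length < m → f.coeff w = 0) (hg : ∀ w, w.length < n → g.coeff w = 0)
    {w : FreeMonoid (Fin k)} (hw : w.length < m + n) : (f * g).coeff w = 0 := by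
  classical
  rw [MonoidAlgebra.coeff_mul]
  refine Finset.sum_eq_zero fun u _ => Finset.sum_eq_zero fun v _ => ?_
  dsimp only
  split_ifs with huv
  · rw [← huv, FreeMonoid.length_mul] at hw
    rcases lt_or_ge u.length m with h | h
    · rw [hf u h, zero_mul]
    · rw [hg v (by omega), mul_zero]
  · rfl

variable (A k) in
/-- The power series of order at least `n`. -/
def ordGE (n : ℕ) : Ideal (FreeAlg A k) where
  carrier := {f | ∀ w : FreeMonoid (Fin k), w.length < n → f.coeff w = 0}
  add_mem' hf hg w hw := by simp [hf w hw, hg w hw]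
  zero_mem' w _ := by simp
  smul_mem' c _ hf w hw :=
    FreeAlg.coeff_mul_eq_zero (m := 0) (fun _ h => absurd h (Nat.not_lt_zero _)) hf
      (by rwa [zero_add])

lemma mem_ordGE_zero (f : FreeAlg A k) : f ∈ ordGE A k 0 :=
  fun _ h => absurd h (Nat.not_lt_zero _)

lemma mul_mem_ordGE {m n : ℕ} {f g : FreeAlg A k} (hf : f ∈ ordGE A k m) (hg : g ∈ ordGE A k n) :
    f * g ∈ ordGE A k (m + n) := fun _ => FreeAlg.coeff_mul_eq_zero hf hg

lemma ordGE_anti {m n : ℕ} (h : m ≤ n) : ordGE A k n ≤ ordGE A k m :=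
  fun _ hf w hw => hf w (hw.trans_le h)

instance (n : ℕ) : (ordGE A k n).IsTwoSided :=
  ⟨fun b ha => by simpa using mul_mem_ordGE ha (mem_ordGE_zero b)⟩

lemma single_mem_ordGE (w : FreeMonoid (Fin k)) (a : A) :
    MonoidAlgebra.single w a ∈ ordGE A k w.length := by
  classical
  intro v hv
  rw [MonoidAlgebra.coeff_single, Finsupp.single_apply, if_neg]
  rintro rfl
  exact hv.false

lemma sub_single_one_mem_ordGE (f : FreeAlg A k) :
    f - MonoidAlgebra.single 1 (f.coeff 1) ∈ ordGE A k 1 := by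
  intro w hw
  obtain rfl : w = 1 := FreeMonoid.length_eq_zero.1 (by omega)
  simp

lemma single_one_mul_comm (a : A) (f : FreeAlg A k) :
    MonoidAlgebra.single 1 a * f = f * MonoidAlgebra.single 1 a :=
  MonoidAlgebra.single_one_comm a f

lemma comm_mem_ordGE {n : ℕ} {f : FreeAlg A k} (hf : f ∈ ordGE A k n) (g : FreeAlg A k) :
    f * g - g * f ∈ ordGE A k (n + 1) := by
  have h := sub_single_one_mem_ordGE g
  have e : f * g - g * f = f * (g - MonoidAlgebra.single 1 (g.coeff 1)) -
      (g - MonoidAlgebra.single 1 (g.coeff 1)) * f := by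
    rw [mul_sub, sub_mul, single_one_mul_comm]
    abel
  rw [e]
  exact sub_mem (mul_mem_ordGE hf h) (add_comm 1 n ▸ mul_mem_ordGE h hf)

lemma comm_mem_ordGE_two (f g : FreeAlg A k) : f * g - g * f ∈ ordGE A k 2 := by
  have e : f * g - g * f = (f - MonoidAlgebra.single 1 (f.coeff 1)) * g -
      g * (f - MonoidAlgebra.single 1 (f.coeff 1)) := by
    rw [mul_sub, sub_mul, single_one_mul_comm]
    abel
  rw [e]
  exact comm_mem_ordGE (sub_single_one_mem_ordGE f) g

/-- An element of order `n ≥ 1` whose commutators with the generators have order `n + 2`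
has order `n + 1`. -/
lemma mem_ordGE_succ_of_comm (hk : 2 ≤ k) {n : ℕ} (hn : 1 ≤ n) {f : FreeAlg A k}
    (hf : f ∈ ordGE A k n)
    (hc : ∀ i, f * MonoidAlgebra.single (.of i) 1 - MonoidAlgebra.single (.of i) 1 * f ∈
      ordGE A k (n + 2)) : f ∈ ordGE A k (n + 1) := by
  intro w hw
  rcases (Nat.lt_succ_iff.1 hw).lt_or_eq with h | h
  · exact hf w h
  cases w using FreeMonoid.casesOn with
  | one => simp at h; omega
  | of_mul j w =>
    have : Nontrivial (Fin k) := Fin.nontrivial_iff_two_le.2 hk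
    obtain ⟨i, hi⟩ := exists_ne j
    have := hc i (.of j * w * .of i) (by simp [← h])
    rwa [MonoidAlgebra.coeff_sub, Finsupp.sub_apply, MonoidAlgebra.coeff_mul_single_mul, mul_one,
      MonoidAlgebra.coeff_single_mul_of_forall_mul_ne, sub_zero] at this
    intro d hd
    rw [mul_assoc] at hd
    exact hi (List.cons.inj (congrArg FreeMonoid.toList hd)).1

variable (A k) in
/-- The filtration by order of a truncation of the free algebra. -/
def truncFil (M n : ℕ) : AddSubgroup (FreeAlg A k ⧸ ordGE A k M) :=
  (ordGE A k n).toAddSubgroup.map (Ideal.Quotient.mk (ordGE A k M) : _ →+ _)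

lemma isCommFiltration_truncFil (M : ℕ) : IsCommFiltration (truncFil A k M) where
  mem_zero x := by
    obtain ⟨f, rfl⟩ := Ideal.Quotient.mk_surjective x
    exact ⟨f, mem_ordGE_zero f, rfl⟩
  anti h := AddSubgroup.map_mono (ordGE_anti h)
  mul_mem := by
    rintro m n _ _ ⟨f, hf, rfl⟩ ⟨g, hg, rfl⟩
    exact ⟨f * g, mul_mem_ordGE hf hg, map_mul (Ideal.Quotient.mk _) f g⟩
  comm_mem := by
    rintro n _ ⟨f, hf, rfl⟩ y
    obtain ⟨g, rfl⟩ := Ideal.Quotient.mk_surjective y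
    exact ⟨f * g - g * f, comm_mem_ordGE hf g, by simp⟩
  comm_mem_two x y := by
    obtain ⟨f, rfl⟩ := Ideal.Quotient.mk_surjective x
    obtain ⟨g, rfl⟩ := Ideal.Quotient.mk_surjective y
    exact ⟨f * g - g * f, comm_mem_ordGE_two f g, by simp⟩

variable [Algebra ℂ A]

lemma isNCNilpotent_trunc (M : ℕ) : IsNCNilpotent (FreeAlg A k ⧸ ordGE A k M) := by
  refine ⟨M, fun x hx => ?_⟩
  obtain ⟨f, hf, rfl⟩ := (isCommFiltration_truncFil M).mem_of_mem_commFiltration hx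
  exact Ideal.Quotient.eq_zero_iff_mem.2 (ordGE_anti (by omega) hf)

lemma isCentralExtension_trunc {M : ℕ} (hM : 1 ≤ M) :
    IsCentralExtension
      (Ideal.Quotient.factorₐ ℂ (ordGE_anti M.le_succ : ordGE A k (M + 1) ≤ ordGE A k M)) where
  surjective := Ideal.Quotient.factor_surjective (ordGE_anti M.le_succ)
  central x hx y := by
    obtain ⟨f, rfl⟩ := Ideal.Quotient.mk_surjective x
    obtain ⟨g, rfl⟩ := Ideal.Quotient.mk_surjective y
    have hf : f ∈ ordGE A k M := Ideal.Quotient.eq_zero_iff_mem.1 hx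
    rw [← map_mul, ← map_mul, Ideal.Quotient.mk_eq_mk_iff_sub_mem]
    exact comm_mem_ordGE hf g
  sq_zero x y hx hy := by
    obtain ⟨f, rfl⟩ := Ideal.Quotient.mk_surjective x
    obtain ⟨g, rfl⟩ := Ideal.Quotient.mk_surjective y
    have hf : f ∈ ordGE A k M := Ideal.Quotient.eq_zero_iff_mem.1 hx
    have hg : g ∈ ordGE A k M := Ideal.Quotient.eq_zero_iff_mem.1 hy
    rw [← map_mul]
    exact Ideal.Quotient.eq_zero_iff_mem.2 (ordGE_anti (by omega) (mul_mem_ordGE hf hg))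

end FreeAlg

end NCGeom

namespace NCGeom

lemma mem_ordGE_of_mk_mem {A : Type} [CommRing A] {k M n : ℕ} (h : n ≤ M) {f : FreeAlg A k}
    (hf : Ideal.Quotient.mk (ordGE A k M) f ∈ truncFil A k M n) : f ∈ ordGE A k n := by
  obtain ⟨g, hg, hfg⟩ := hf
  have : f - g ∈ ordGE A k M := Ideal.Quotient.mk_eq_mk_iff_sub_mem _ _ |>.1 hfg.symm
  simpa using add_mem (ordGE_anti h this) hg

lemma mk_single_one_comm {A : Type} [CommRing A] {k M : ℕ} (a : A)
    (y : FreeAlg A k ⧸ ordGE A k M) :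
    Ideal.Quotient.mk (ordGE A k M) (MonoidAlgebra.single 1 a) * y =
      y * Ideal.Quotient.mk (ordGE A k M) (MonoidAlgebra.single 1 a) := by
  obtain ⟨f, rfl⟩ := Ideal.Quotient.mk_surjective y
  rw [← map_mul, ← map_mul, single_one_mul_comm]

variable {R : Type} [Ring R] [Algebra ℂ R] {S : Type} [CommRing S] [Algebra ℂ S]
  (π : R →ₐ[ℂ] S) {p : Ideal S} [p.IsPrime] {k : ℕ} (C : LocalCoords p k)

namespace LocalCoords

/-- The linear part of the Taylor expansion of a function. -/
def linearPart (s : S) : FreeAlg (Localization.AtPrime p) k :=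
  MonoidAlgebra.single 1 (algebraMap S _ s) + ∑ i, MonoidAlgebra.single (.of i) (C.d i s)

lemma sum_single_mem (s : S) :
    ∑ i, MonoidAlgebra.single (.of i) (C.d i s) ∈ ordGE (Localization.AtPrime p) k 1 :=
  sum_mem fun i _ => ordGE_anti (FreeMonoid.length_of i).ge (single_mem_ordGE _ _)

lemma linearPart_mul (a b : S) :
    C.linearPart (a * b) - C.linearPart a * C.linearPart b ∈ ordGE (Localization.AtPrime p) k 2 := by
  have e : C.linearPart (a * b) - C.linearPart a * C.linearPart b =
      -((∑ i, MonoidAlgebra.single (.of i) (C.d i a)) *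
        ∑ i, MonoidAlgebra.single (.of i) (C.d i b)) := by
    have h : ∑ i, MonoidAlgebra.single (FreeMonoid.of i) (C.d i (a * b)) =
        MonoidAlgebra.single 1 (algebraMap S _ a) * (∑ i, MonoidAlgebra.single (.of i) (C.d i b)) +
        (∑ i, MonoidAlgebra.single (.of i) (C.d i a)) *
          MonoidAlgebra.single 1 (algebraMap S _ b) := by
      simp only [Finset.mul_sum, Finset.sum_mul, MonoidAlgebra.single_mul_single, one_mul, mul_one,
        ← Finset.sum_add_distrib, ← MonoidAlgebra.single_add]
      refine Finset.sum_congr rfl fun i _ => ?_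
      rw [Derivation.leibniz, Algebra.smul_def, Algebra.smul_def, mul_comm (algebraMap S _ b)]
    rw [linearPart, h, linearPart, linearPart, map_mul,
      ← one_mul (1 : FreeMonoid (Fin k)), ← MonoidAlgebra.single_mul_single, one_mul]
    noncomm_ring
  rw [e]
  exact neg_mem (mul_mem_ordGE (C.sum_single_mem a) (C.sum_single_mem b))

/-- The linear part as a homomorphism to the free algebra modulo order two. -/
def linearPartHom :
    S →ₐ[ℂ] FreeAlg (Localization.AtPrime p) k ⧸ ordGE (Localization.AtPrime p) k 2 where
  toFun s := Ideal.Quotient.mk _ (C.linearPart s)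
  map_one' := by
    simp [linearPart, ← MonoidAlgebra.one_def]
  map_zero' := by
    simp [linearPart]
  map_add' a b := by
    rw [← map_add]
    congr 1
    simp only [linearPart, map_add, MonoidAlgebra.single_add, Finset.sum_add_distrib]
    abel
  map_mul' a b := by
    rw [← map_mul, Ideal.Quotient.mk_eq_mk_iff_sub_mem]
    exact C.linearPart_mul a b
  commutes' c := by
    simp only [linearPart, Derivation.map_algebraMap, MonoidAlgebra.single_zero,
      Finset.sum_const_zero, add_zero]
    rfl

end LocalCoords

/-- A homomorphism to the truncated free algebra over a local ring of `R^{ab}` extending the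
linear part of the Taylor expansion. -/
structure Expansion (M : ℕ) where
  hom : R →ₐ[ℂ] FreeAlg (Localization.AtPrime p) k ⧸ ordGE (Localization.AtPrime p) k M
  hom_sub_mem : ∀ r, hom r - Ideal.Quotient.mk _ (C.linearPart (π r)) ∈ truncFil _ _ M 2

variable {π} in
lemma IsNCSmooth.exists_expansion (hsm : IsNCSmooth R) (M : ℕ) :
    Nonempty (Expansion π C (M + 2)) := by
  induction M with
  | zero => exact ⟨C.linearPartHom.comp π, fun r => by
      rw [show C.linearPartHom.comp π r = Ideal.Quotient.mk _ (C.linearPart (π r)) from rfl,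
        sub_self]
      exact zero_mem _⟩
  | succ M ih =>
    obtain ⟨E⟩ := ih
    obtain ⟨g, hg⟩ := hsm.2 _ _ _ _ _ _ (isNCNilpotent_trunc _) (isNCNilpotent_trunc _) _
      (isCentralExtension_trunc (M := M + 2) (by omega)) E.hom
    refine ⟨g, fun r => ?_⟩
    obtain ⟨t, ht⟩ := Ideal.Quotient.mk_surjective (g r)
    rw [← ht, ← map_sub]
    refine ⟨_, mem_ordGE_of_mk_mem (M := M + 2) (by omega) ?_, rfl⟩
    rw [map_sub]
    convert E.hom_sub_mem r
    rw [← hg, AlgHom.comp_apply, ← ht]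
    rfl

namespace Expansion

variable {π C} {M : ℕ} (E : Expansion π C M)

lemma hom_mem {n : ℕ} {r : R} (hr : r ∈ commFiltration R n) : E.hom r ∈ truncFil _ _ M n :=
  (isCommFiltration_truncFil M).mem_of_mem_commFiltration (map_mem_commFiltration E.hom hr)

lemma hom_sub_single_mem (r : R) :
    E.hom r - Ideal.Quotient.mk _ (MonoidAlgebra.single 1 (algebraMap S _ (π r))) ∈
      truncFil _ _ M 1 := by
  have h1 := (isCommFiltration_truncFil M).anti one_le_two (E.hom_sub_mem r)
  have h2 := add_mem h1 ⟨_, C.sum_single_mem (π r), rfl⟩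
  convert h2 using 1
  rw [LocalCoords.linearPart, map_add]
  change E.hom r - Ideal.Quotient.mk _ _ = E.hom r - (Ideal.Quotient.mk _ _ +
    Ideal.Quotient.mk _ _) + Ideal.Quotient.mk _ _
  rw [sub_add_eq_sub_sub, sub_add_cancel]

lemma hom_sub_mem_gen {i : Fin k} {x : R} (hx : π x = C.x i) :
    E.hom x - Ideal.Quotient.mk _ (MonoidAlgebra.single 1 (algebraMap S _ (π x))) -
      Ideal.Quotient.mk _ (MonoidAlgebra.single (.of i) 1) ∈ truncFil _ _ M 2 := by
  convert E.hom_sub_mem x using 1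
  rw [LocalCoords.linearPart, map_add, ← sub_sub]
  congr 2
  rw [Finset.sum_eq_single i]
  · rw [hx, C.d_x, if_pos rfl]
  · intro j _ hj
    rw [hx, C.d_x, if_neg hj, MonoidAlgebra.single_zero]
  · simp

/-- An element whose commutators with the coordinates have weight `n + 2` has a Taylor expansion
without terms of degree `n`. -/
lemma hom_sub_mem_of_comm (hk : 2 ≤ k) {n : ℕ} (hn : 1 ≤ n) (hM : n + 2 ≤ M) {x : Fin k → R}
    (hx : ∀ i, π (x i) = C.x i) {z : R} (a : Localization.AtPrime p)
    (hz : E.hom z - Ideal.Quotient.mk _ (MonoidAlgebra.single 1 a) ∈ truncFil _ _ M n)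
    (hc : ∀ i, z * x i - x i * z ∈ commFiltration R (n + 2)) :
    E.hom z - Ideal.Quotient.mk _ (MonoidAlgebra.single 1 a) ∈ truncFil _ _ M (n + 1) := by
  have hT := isCommFiltration_truncFil (A := Localization.AtPrime p) (k := k) M
  obtain ⟨t, ht⟩ := Ideal.Quotient.mk_surjective
    (E.hom z - Ideal.Quotient.mk _ (MonoidAlgebra.single 1 a))
  rw [← ht] at hz
  have htn := mem_ordGE_of_mk_mem (by omega) hz
  rw [← ht]
  refine ⟨t, mem_ordGE_succ_of_comm hk hn htn fun i => mem_ordGE_of_mk_mem hM ?_, rfl⟩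
  have h1 := E.hom_mem (hc i)
  have h2 := E.hom_sub_mem_gen (hx i)
  have c1 := mk_single_one_comm a (E.hom (x i))
  have c2 := mk_single_one_comm (algebraMap S _ (π (x i))) (Ideal.Quotient.mk (ordGE _ k M) t)
  set e := E.hom (x i) - Ideal.Quotient.mk _ (MonoidAlgebra.single 1 (algebraMap S _ (π (x i)))) -
      Ideal.Quotient.mk _ (MonoidAlgebra.single (.of i) 1) with he
  have h3 := sub_mem (sub_mem h1 (hT.mul_mem hz h2)) (neg_mem (add_comm 2 n ▸ hT.mul_mem h2 hz))
  convert h3 using 1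
  have hX : Ideal.Quotient.mk _ (MonoidAlgebra.single (.of i) 1) = E.hom (x i) -
      Ideal.Quotient.mk _ (MonoidAlgebra.single 1 (algebraMap S _ (π (x i)))) - e := by
    rw [he]
    abel
  rw [map_sub, map_mul, map_mul, hX, map_sub, map_mul, map_mul]
  simp only [mul_sub, sub_mul, c2]
  rw [ht]
  simp only [mul_sub, sub_mul, c1]
  abel

end Expansion

end NCGeom

namespace NCGeom

variable {R : Type} [Ring R] [Algebra ℂ R] {S : Type} [CommRing S] [Algebra ℂ S]

/-- A derivation from a noncommutative algebra to a module over its quotient is determined by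
Kähler differentials of the quotient. -/
lemma smul_eq_sum_of_smul_D_eq {π : R →ₐ[ℂ] S} (hπ : Function.Surjective π) {N : Type}
    [AddCommGroup N] [Module R N] (hN : ∀ a, π a = 0 → ∀ y : N, a • y = 0) (δ : R →+ N)
    (hδ : ∀ a, π a = 0 → δ a = 0) (hmul : ∀ a b, δ (a * b) = a • δ b + b • δ a)
    (hC : ∀ c : ℂ, δ (algebraMap ℂ R c) = 0) {k : ℕ} {h b : R} {c x : Fin k → R}
    (e : π h • KaehlerDifferential.D ℂ S (π b) =
      ∑ i, π (c i) • KaehlerDifferential.D ℂ S (π (x i))) :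
    h • δ b = ∑ i, c i • δ (x i) := by
  let σ := Function.surjInv hπ
  have hσ (s : S) : π (σ s) = s := Function.surjInv_eq hπ s
  have key {a a' : R} (ha : π a = π a') (y : N) : a • y = a' • y := by
    rw [← sub_eq_zero, ← sub_smul]
    exact hN _ (by rw [map_sub, ha, sub_self]) y
  have keyδ {a a' : R} (ha : π a = π a') : δ a = δ a' := by
    rw [← sub_eq_zero, ← map_sub]
    exact hδ _ (by rw [map_sub, ha, sub_self])
  let _ : Module S N :=
    { smul s y := σ s • y
      one_smul y := (key (by rw [hσ, map_one]) y).trans (one_smul R y)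
      mul_smul s t y := (key (by rw [map_mul, hσ, hσ, hσ]) y).trans (mul_smul (σ s) (σ t) y)
      smul_zero s := smul_zero (σ s)
      smul_add s := smul_add (σ s)
      add_smul s t y := (key (by rw [map_add, hσ, hσ, hσ]) y).trans (add_smul (σ s) (σ t) y)
      zero_smul y := (key (by rw [hσ, map_zero]) y).trans (zero_smul R y) }
  have hsmul (a : R) (y : N) : π a • y = a • y := key (hσ _) y
  let _ : Module ℂ N := Module.compHom N (algebraMap ℂ S)
  have : IsScalarTower ℂ S N := ⟨fun c s y => by
    rw [Algebra.smul_def, mul_smul]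
    rfl⟩
  let D : Derivation ℂ S N :=
    { toFun s := δ (σ s)
      map_add' s t := by
        rw [← map_add]
        exact keyδ (by rw [map_add, hσ, hσ, hσ])
      map_smul' c s := by
        rw [keyδ (a' := algebraMap ℂ R c * σ s), hmul, hC, smul_zero, add_zero, ← hsmul,
          AlgHom.commutes]
        · rfl
        · rw [map_mul, hσ, hσ, AlgHom.commutes, Algebra.smul_def]
      map_one_eq_zero' := by
        change δ (σ 1) = 0
        rw [keyδ (a' := algebraMap ℂ R 1), hC]
        rw [hσ, map_one, map_one]
      leibniz' s t := by
        change δ (σ (s * t)) = σ s • δ (σ t) + σ t • δ (σ s)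
        rw [← hmul]
        exact keyδ (by rw [map_mul, hσ, hσ, hσ]) }
  have hD (a : R) : D (π a) = δ a := keyδ (hσ _)
  have := congrArg D.liftKaehlerDifferential e
  simpa only [map_smul, map_sum, Derivation.liftKaehlerDifferential_comp_D, hD, hsmul] using this

lemma comm_mem_add_two {n : ℕ} {z a : R} (hz : z ∈ commFiltration R n)
    (ha : a ∈ commFiltration R 2) : z * a - a * z ∈ commFiltration R (n + 2) := by
  have hP := isCommFiltration_commFil R
  change _ ∈ commFil R (n + 2)
  induction ha using commFiltration_induction with
  | zero => simp
  | add x y _ _ hx hy =>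
    convert add_mem hx hy using 1
    noncomm_ring
  | neg x _ hx =>
    convert neg_mem hx using 1
    noncomm_ring
  | prod N x hN hx =>
    cases hx with
    | base => omega
    | cons r ha hy =>
      rename_i i N a y
      induction ha using Submodule.span_induction with
      | zero => simp
      | add a b _ _ ha hb =>
        convert add_mem ha hb using 1
        noncomm_ring
      | smul c a _ ha =>
        convert hP.mul_mem_left (algebraMap ℂ R c) ha using 1
        simp only [← Algebra.smul_def, smul_sub, mul_smul_comm, smul_mul_assoc]
      | mem a ha =>
        obtain ⟨u, _, v, rfl⟩ := ha
        have h1 := hP.mul_mem_right (hP.mul_mem (hP.comm_mem hz r) (hP.comm_mem_two u v)) y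
        have h2 := hP.mul_mem (hP.mul_mem_left r (hP.comm_mem_two u v)) (hP.comm_mem hz y)
        have h3 := sub_mem (hP.comm_mem (hP.comm_mem hz u) v) (hP.comm_mem (hP.comm_mem hz v) u)
        have h4 := hP.mul_mem_right (hP.mul_mem_left r h3) y
        convert add_mem (add_mem (hP.anti (by omega) h1) (hP.anti (by omega) h2)) h4 using 1
        noncomm_ring

/-- The span of the commutators `[z, x i]` absorbs a multiple of all commutators `[z, b]`. -/
lemma mul_comm_sub_sum_mem {π : R →ₐ[ℂ] S} (hπ : IsAbelianization π) {m : ℕ} {z : R}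
    (h1 : ∀ a ∈ commFiltration R 2, ∀ b, a * (z * b - b * z) ∈ commFiltration R m)
    (h2 : ∀ a ∈ commFiltration R 2, z * a - a * z ∈ commFiltration R m)
    (h3 : ∀ a b, (z * a - a * z) * b - b * (z * a - a * z) ∈ commFiltration R m)
    {k : ℕ} {h b : R} {c x : Fin k → R}
    (e : π h • KaehlerDifferential.D ℂ S (π b) =
      ∑ i, π (c i) • KaehlerDifferential.D ℂ S (π (x i))) :
    h * (z * b - b * z) - ∑ i, c i * (z * x i - x i * z) ∈ commFiltration R m := by
  let J : Submodule R R :=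
    { commFil R m with smul_mem' := fun a y hy => (isCommFiltration_commFil R).mul_mem_left a hy }
  let N : Submodule R (R ⧸ J) :=
    { carrier := {y | ∀ a, π a = 0 → a • y = 0}
      add_mem' := fun hx hy a ha => by rw [smul_add, hx a ha, hy a ha, add_zero]
      zero_mem' := fun a _ => smul_zero a
      smul_mem' := fun r y hy a ha => by
        rw [← mul_smul]
        exact hy _ (by rw [map_mul, ha, zero_mul]) }
  let δ : R →+ N :=
    { toFun b := ⟨J.mkQ (z * b - b * z), fun a ha =>
        (Submodule.Quotient.mk_eq_zero J).2 (h1 a ((hπ.2 a).1 ha) b)⟩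
      map_zero' := by
        ext
        simp
      map_add' a b := by
        ext
        change J.mkQ _ = J.mkQ _ + J.mkQ _
        rw [← map_add]
        congr 1
        noncomm_ring }
  have := smul_eq_sum_of_smul_D_eq hπ.1 (N := N) (fun a ha y => Subtype.ext (y.2 a ha)) δ
    (fun a ha => Subtype.ext ((Submodule.Quotient.mk_eq_zero J).2 (h2 a ((hπ.2 a).1 ha))))
    (fun a b => Subtype.ext ((Submodule.Quotient.eq J).2 ?_))
    (fun c => Subtype.ext ((Submodule.Quotient.mk_eq_zero J).2 ?_)) e
  · have e' := congrArg Subtype.val this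
    rw [AddSubmonoidClass.coe_finsetSum] at e'
    have e'' : J.mkQ (h * (z * b - b * z)) = J.mkQ (∑ i, c i * (z * x i - x i * z)) := by
      rw [map_sum]
      exact e'
    exact (Submodule.Quotient.eq J).1 e''
  · change _ ∈ J
    convert (show _ ∈ J from h3 a b) using 1
    simp only [smul_eq_mul]
    noncomm_ring
  · rw [Algebra.commutes, sub_self]
    exact J.zero_mem

end NCGeom

namespace NCGeom

/-- The homogeneous noncommutative polynomials of degree `n`. -/
def homog (k n : ℕ) : Submodule ℂ (FreeAlg ℂ k) where
  carrier := {f | ∀ w : FreeMonoid (Fin k), w.length ≠ n → f.coeff w = 0}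
  add_mem' hf hg w hw := by simp [hf w hw, hg w hw]
  zero_mem' w _ := by simp
  smul_mem' c f hf w hw := by simp [hf w hw]

lemma mul_mem_homog {k m n : ℕ} {f g : FreeAlg ℂ k} (hf : f ∈ homog k m) (hg : g ∈ homog k n) :
    f * g ∈ homog k (m + n) := by
  classical
  intro w hw
  rw [MonoidAlgebra.coeff_mul]
  refine Finset.sum_eq_zero fun u _ => Finset.sum_eq_zero fun v _ => ?_
  dsimp only
  split_ifs with huv
  · rw [← huv, FreeMonoid.length_mul] at hw
    by_cases h : u.length = m
    · rw [hg v (by omega), mul_zero]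
    · rw [hf u h, zero_mul]
  · rfl

lemma single_mem_homog {k : ℕ} (w : FreeMonoid (Fin k)) (a : ℂ) :
    MonoidAlgebra.single w a ∈ homog k w.length := by
  classical
  intro v hv
  rw [MonoidAlgebra.coeff_single, Finsupp.single_apply, if_neg]
  rintro rfl
  exact hv rfl

/-- Extension of scalars for noncommutative polynomials. -/
abbrev baseChange (A : Type) [CommRing A] [Algebra ℂ A] (k : ℕ) : FreeAlg ℂ k →+* FreeAlg A k :=
  MonoidAlgebra.mapRingHom _ (algebraMap ℂ A)

lemma baseChange_mem_ordGE {A : Type} [CommRing A] [Algebra ℂ A] {k n : ℕ} {f : FreeAlg ℂ k}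
    (hf : f ∈ homog k n) : baseChange A k f ∈ ordGE A k n := fun w hw => by
  rw [MonoidAlgebra.coeff_mapRingHom, hf w hw.ne, map_zero]

variable {R : Type} [Ring R] [Algebra ℂ R] {S : Type} [CommRing S] [Algebra ℂ S]

/-- Evaluation of noncommutative polynomials. -/
def evalFree {k : ℕ} (x : Fin k → R) : FreeAlg ℂ k →ₐ[ℂ] R :=
  MonoidAlgebra.lift ℂ R _ (FreeMonoid.lift x)

@[simp] lemma evalFree_single_of {k : ℕ} (x : Fin k → R) (i : Fin k) :
    evalFree x (MonoidAlgebra.single (.of i) 1) = x i := by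
  simp [evalFree]

namespace Expansion

variable {π : R →ₐ[ℂ] S} {p : Ideal S} [p.IsPrime] {k : ℕ} {C : LocalCoords p k} {M : ℕ}
  (E : Expansion π C M)

/-- The homogeneous polynomials of degree `n` whose values have weight `n` and which are the
leading terms of their values. -/
def leadForms (x : Fin k → R) (n : ℕ) : Submodule ℂ (FreeAlg ℂ k) where
  carrier := {f | f ∈ homog k n ∧ evalFree x f ∈ commFil R n ∧
    E.hom (evalFree x f) - Ideal.Quotient.mk _ (baseChange _ k f) ∈ truncFil _ _ M (n + 1)}
  add_mem' {f g} hf hg := by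
    refine ⟨add_mem hf.1 hg.1, by simpa using add_mem hf.2.1 hg.2.1, ?_⟩
    convert add_mem hf.2.2 hg.2.2 using 1
    simp only [map_add]
    abel
  zero_mem' := ⟨zero_mem _, by simp, by simp⟩
  smul_mem' c f hf := by
    refine ⟨Submodule.smul_mem _ c hf.1, ?_, ?_⟩
    · rw [map_smul, Algebra.smul_def]
      exact (isCommFiltration_commFil R).mul_mem_left _ hf.2.1
    · convert (isCommFiltration_truncFil M).mul_mem_left (algebraMap ℂ _ c) hf.2.2 using 1
      rw [← Algebra.smul_def, smul_sub, map_smul, map_smul]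
      congr 1
      rw [Algebra.smul_def c f, map_mul, map_mul, Algebra.smul_def c (Ideal.Quotient.mk _ _)]
      congr 1
      change _ = Ideal.Quotient.mk _ (algebraMap ℂ (FreeAlg (Localization.AtPrime p) k) c)
      congr 1
      simp

lemma one_mem_leadForms (x : Fin k → R) : 1 ∈ E.leadForms x 0 :=
  ⟨single_mem_homog 1 1, mem_commFiltration_zero _, by simp⟩

variable {x : Fin k → R}

lemma mul_mem_leadForms {m n : ℕ} {f g : FreeAlg ℂ k} (hf : f ∈ E.leadForms x m)
    (hg : g ∈ E.leadForms x n) : f * g ∈ E.leadForms x (m + n) := by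
  have hT := isCommFiltration_truncFil (A := Localization.AtPrime p) (k := k) M
  refine ⟨mul_mem_homog hf.1 hg.1, ?_, ?_⟩
  · rw [map_mul]
    exact (isCommFiltration_commFil R).mul_mem hf.2.1 hg.2.1
  · have h1 := hT.mul_mem hf.2.2 (E.hom_mem hg.2.1)
    have h2 := hT.mul_mem (⟨_, baseChange_mem_ordGE hf.1, rfl⟩ :
      Ideal.Quotient.mk _ (baseChange _ k f) ∈ truncFil (Localization.AtPrime p) k M m) hg.2.2
    convert add_mem (add_right_comm m 1 n ▸ h1) (add_assoc m n 1 ▸ h2) using 1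
    rw [map_mul, map_mul, map_mul, map_mul]
    noncomm_ring

lemma comm_mem_leadForms_aux (hx : ∀ i, π (x i) = C.x i) {n : ℕ} {f : FreeAlg ℂ k} (i : Fin k)
    (hf : f ∈ homog k n)
    (hc : evalFree x f * x i - x i * evalFree x f ∈ commFiltration R (n + 1))
    (a : Localization.AtPrime p)
    (he : E.hom (evalFree x f) - Ideal.Quotient.mk _ (MonoidAlgebra.single 1 a) -
      Ideal.Quotient.mk _ (baseChange _ k f) ∈ truncFil _ _ M (n + 1)) :
    f * MonoidAlgebra.single (.of i) 1 - MonoidAlgebra.single (.of i) 1 * f ∈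
      E.leadForms x (n + 1) := by
  have hT := isCommFiltration_truncFil (A := Localization.AtPrime p) (k := k) M
  have hX : MonoidAlgebra.single (FreeMonoid.of i) (1 : ℂ) ∈ homog k 1 := single_mem_homog (.of i) 1
  refine ⟨sub_mem (mul_mem_homog hf hX) (add_comm 1 n ▸ mul_mem_homog hX hf), ?_, ?_⟩
  · rw [map_sub, map_mul, map_mul, evalFree_single_of]
    exact hc
  set b := algebraMap S (Localization.AtPrime p) (π (x i))
  have he' := E.hom_sub_mem_gen (hx i)
  set e := E.hom (evalFree x f) - Ideal.Quotient.mk _ (MonoidAlgebra.single 1 a) -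
      Ideal.Quotient.mk _ (baseChange _ k f) with e_def
  set e' := E.hom (x i) - Ideal.Quotient.mk _ (MonoidAlgebra.single 1 b) -
      Ideal.Quotient.mk _ (MonoidAlgebra.single (.of i) 1) with e'_def
  have hF : Ideal.Quotient.mk _ (baseChange _ k f) ∈ truncFil (Localization.AtPrime p) k M n :=
    ⟨_, baseChange_mem_ordGE hf, rfl⟩
  have h1 := hT.comm_mem he (E.hom (x i))
  have h2 := hT.mul_mem hF he'
  have h3 := add_comm 2 n ▸ hT.mul_mem he' hF
  convert add_mem h1 (sub_mem h2 h3) using 1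
  have c1 := mk_single_one_comm a (E.hom (x i))
  have c2 := mk_single_one_comm b (Ideal.Quotient.mk (ordGE _ k M) (baseChange _ k f))
  simp only [e_def, e'_def, map_sub, map_mul, evalFree_single_of, MonoidAlgebra.mapRingHom_single,
    map_one, sub_mul, mul_sub, c1, c2]
  abel

lemma comm_mem_leadForms (hx : ∀ i, π (x i) = C.x i) {n : ℕ} {f : FreeAlg ℂ k} (i : Fin k)
    (hf : f ∈ E.leadForms x n) :
    f * MonoidAlgebra.single (.of i) 1 - MonoidAlgebra.single (.of i) 1 * f ∈
      E.leadForms x (n + 1) :=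
  E.comm_mem_leadForms_aux hx i hf.1 ((isCommFiltration_commFil R).comm_mem hf.2.1 _) 0
    (by simpa using hf.2.2)

lemma comm_gen_mem_leadForms (hx : ∀ i, π (x i) = C.x i) (i j : Fin k) :
    MonoidAlgebra.single (.of i) 1 * MonoidAlgebra.single (.of j) 1 -
      MonoidAlgebra.single (.of j) 1 * MonoidAlgebra.single (.of i) 1 ∈ E.leadForms x 2 :=
  E.comm_mem_leadForms_aux hx j (single_mem_homog (.of i) 1)
    (by
      simp only [evalFree_single_of]
      exact (isCommFiltration_commFil R).comm_mem_two (x i) (x j))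
    (algebraMap S _ (π (x i))) (by simpa using E.hom_sub_mem_gen (hx i))

end Expansion

end NCGeom

namespace NCGeom

variable {R : Type} [Ring R] [Algebra ℂ R] {S : Type} [CommRing S] [Algebra ℂ S]

lemma mem_sup_of_mem_commFil {n : ℕ} (K : Ideal R) {z : R} (hz : z ∈ commFil R n) :
    z ∈ K ⊔ (commFiltration R n).asIdeal :=
  Submodule.mem_sup_right (TwoSidedIdeal.mem_asIdeal.2 hz)

lemma mul_mul_mem_sup {n : ℕ} {K : Ideal R} {h z : R} (hz : z ∈ commFil R n)
    (hhz : h * z ∈ K ⊔ (commFiltration R (n + 1)).asIdeal) (r : R) :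
    h * (r * z) ∈ K ⊔ (commFiltration R (n + 1)).asIdeal := by
  have hP := isCommFiltration_commFil R
  have h1 := hP.anti (by omega : n + 1 ≤ 2 + n) (hP.mul_mem (hP.comm_mem_two h r) hz)
  have e : h * (r * z) = r * (h * z) + (h * r - r * h) * z := by noncomm_ring
  rw [e]
  exact add_mem (Ideal.mul_mem_left _ r hhz) (mem_sup_of_mem_commFil K h1)

/-- The elements of weight `n` that lie in `K + I_{n+1}` locally at `p`. -/
def localSat (π : R →ₐ[ℂ] S) (p : Ideal S) [p.IsPrime] (n : ℕ) (K : Ideal R) : Ideal R where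
  carrier := {z | z ∈ commFil R n ∧ ∃ h, π h ∉ p ∧ h * z ∈ K ⊔ (commFiltration R (n + 1)).asIdeal}
  add_mem' := by
    rintro z w ⟨hz, g, hg, hgz⟩ ⟨hw, h, hh, hhw⟩
    refine ⟨add_mem hz hw, h * g, ?_, ?_⟩
    · rw [map_mul]
      exact Ideal.IsPrime.mul_notMem ‹_› hh hg
    · rw [mul_add]
      refine add_mem ?_ ?_
      · rw [mul_assoc]
        exact Ideal.mul_mem_left _ h hgz
      · rw [mul_assoc]
        exact mul_mul_mem_sup hw hhw g
  zero_mem' := ⟨zero_mem _, 1, by simpa using (Ideal.ne_top_iff_one p).1 Ideal.IsPrime.ne_top',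
    by simp⟩
  smul_mem' r z := by
    rintro ⟨hz, h, hh, hhz⟩
    exact ⟨(isCommFiltration_commFil R).mul_mem_left r hz, h, hh, mul_mul_mem_sup hz hhz r⟩

section localSat

variable {π : R →ₐ[ℂ] S} {p : Ideal S} [p.IsPrime] {n : ℕ} {K : Ideal R}

lemma mem_localSat_of_mem_commFil {z : R} (hz : z ∈ commFil R (n + 1)) :
    z ∈ localSat π p n K :=
  ⟨commFiltration_anti n.le_succ hz, 1,
    by simpa using (Ideal.ne_top_iff_one p).1 Ideal.IsPrime.ne_top',
    by simpa using mem_sup_of_mem_commFil K hz⟩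

lemma mem_localSat_of_mem {z : R} (hz : z ∈ commFil R n) (hK : z ∈ K) : z ∈ localSat π p n K :=
  ⟨hz, 1, by simpa using (Ideal.ne_top_iff_one p).1 Ideal.IsPrime.ne_top',
    by simpa using Submodule.mem_sup_left hK⟩

lemma mem_localSat_of_mul_mem {z h : R} (hz : z ∈ commFil R n) (hh : π h ∉ p)
    (hhz : h * z ∈ localSat π p n K) : z ∈ localSat π p n K := by
  obtain ⟨-, g, hg, hgz⟩ := hhz
  refine ⟨hz, g * h, ?_, by rwa [mul_assoc]⟩
  rw [map_mul]
  exact Ideal.IsPrime.mul_notMem ‹_› hg hh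

end localSat

namespace Expansion

variable {π : R →ₐ[ℂ] S} {p : Ideal S} [p.IsPrime] {k : ℕ} {C : LocalCoords p k} {M : ℕ}
  (E : Expansion π C M) (x : Fin k → R)

/-- The elements of weight `n` that are locally `R`-combinations of values of leading forms,
up to weight `n + 1`. -/
def formSat (n : ℕ) : Ideal R :=
  localSat π p n (Ideal.span (evalFree x '' E.leadForms x n))

variable {x}

lemma formSat_le {n : ℕ} {z : R} (hz : z ∈ E.formSat x n) : z ∈ commFil R n := hz.1

lemma mem_formSat_zero (r : R) : r ∈ E.formSat x 0 := by
  refine mem_localSat_of_mem (mem_commFiltration_zero r) ?_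
  have h : (1 : R) ∈ Ideal.span (evalFree x '' E.leadForms x 0) :=
    Ideal.subset_span ⟨1, E.one_mem_leadForms x, map_one _⟩
  simpa using Ideal.mul_mem_left _ r h

lemma evalFree_mem_formSat {n : ℕ} {f : FreeAlg ℂ k} (hf : f ∈ E.leadForms x n) :
    evalFree x f ∈ E.formSat x n :=
  mem_localSat_of_mem hf.2.1 (Ideal.subset_span ⟨f, hf, rfl⟩)

/-- Every element of `formSat` is locally a combination of values of leading forms. -/
lemma formSat_induction {n : ℕ} {P : R → Prop}
    (eval : ∀ f ∈ E.leadForms x n, P (evalFree x f)) (weight : ∀ z ∈ commFil R (n + 1), P z)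
    (add : ∀ z w, z ∈ commFil R n → w ∈ commFil R n → P z → P w → P (z + w))
    (smul : ∀ r z, z ∈ commFil R n → P z → P (r * z))
    (local_mem : ∀ h z, z ∈ commFil R n → π h ∉ p → P (h * z) → P z)
    {z : R} (hz : z ∈ E.formSat x n) : P z := by
  obtain ⟨hz, h, hh, hhz⟩ := hz
  refine local_mem h z hz hh ?_
  obtain ⟨u, hu, v, hv, e⟩ := Submodule.mem_sup.1 hhz
  have hv : v ∈ commFil R (n + 1) := TwoSidedIdeal.mem_asIdeal.1 hv
  suffices h : u ∈ commFil R n ∧ P u by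
    rw [← e]
    exact add _ _ h.1 (commFiltration_anti n.le_succ hv) h.2 (weight v hv)
  clear e
  induction hu using Submodule.span_induction with
  | mem u hu =>
    obtain ⟨f, hf, rfl⟩ := hu
    exact ⟨hf.2.1, eval f hf⟩
  | zero => exact ⟨zero_mem _, weight 0 (zero_mem _)⟩
  | add u v _ _ hu hv => exact ⟨add_mem hu.1 hv.1, add _ _ hu.1 hv.1 hu.2 hv.2⟩
  | smul r u _ hu =>
    exact ⟨(isCommFiltration_commFil R).mul_mem_left r hu.1, smul r u hu.1 hu.2⟩

lemma mul_mem_formSat {m n : ℕ} {z w : R} (hz : z ∈ E.formSat x m) (hw : w ∈ E.formSat x n) :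
    z * w ∈ E.formSat x (m + n) := by
  have hP := isCommFiltration_commFil R
  have hw' := E.formSat_le hw
  refine E.formSat_induction (P := fun z => z * w ∈ E.formSat x (m + n)) ?_ ?_ ?_ ?_ ?_ hz
  · intro f hf
    refine E.formSat_induction (P := fun w => evalFree x f * w ∈ E.formSat x (m + n))
      ?_ ?_ ?_ ?_ ?_ hw
    · intro g hg
      rw [← map_mul]
      exact E.evalFree_mem_formSat (E.mul_mem_leadForms hf hg)
    · intro w hw
      exact mem_localSat_of_mem_commFil (hP.mul_mem (m := m) (n := n + 1) hf.2.1 hw)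
    · intro w w' hw hw' h h'
      rw [mul_add]
      exact add_mem h h'
    · intro r w hw h
      have e : evalFree x f * (r * w) = r * (evalFree x f * w) +
        (evalFree x f * r - r * evalFree x f) * w := by noncomm_ring
      rw [e]
      exact add_mem (Ideal.mul_mem_left _ r h) (mem_localSat_of_mem_commFil
        (add_right_comm m 1 n ▸ hP.mul_mem (hP.comm_mem hf.2.1 r) hw))
    · intro r w hw hr h
      refine mem_localSat_of_mul_mem (hP.mul_mem hf.2.1 hw) hr ?_
      have e : r * (evalFree x f * w) = evalFree x f * (r * w) -
        (evalFree x f * r - r * evalFree x f) * w := by noncomm_ring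
      rw [e]
      exact sub_mem h (mem_localSat_of_mem_commFil
        (add_right_comm m 1 n ▸ hP.mul_mem (hP.comm_mem hf.2.1 r) hw))
  · intro z hz
    exact mem_localSat_of_mem_commFil (add_right_comm m 1 n ▸ hP.mul_mem hz hw')
  · intro z z' _ _ h h'
    rw [add_mul]
    exact add_mem h h'
  · intro r z _ h
    rw [mul_assoc]
    exact Ideal.mul_mem_left _ r h
  · intro r z hz hr h
    refine mem_localSat_of_mul_mem (hP.mul_mem hz hw') hr ?_
    rwa [← mul_assoc]

lemma comm_gen_mem_formSat (hx : ∀ i, π (x i) = C.x i) {n : ℕ} {z : R}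
    (hz : z ∈ E.formSat x n) (i : Fin k) : z * x i - x i * z ∈ E.formSat x (n + 1) := by
  have hP := isCommFiltration_commFil R
  refine E.formSat_induction (P := fun z => z * x i - x i * z ∈ E.formSat x (n + 1))
    ?_ ?_ ?_ ?_ ?_ hz
  · intro f hf
    simpa using E.evalFree_mem_formSat (E.comm_mem_leadForms hx i hf)
  · intro z hz
    exact mem_localSat_of_mem_commFil (hP.comm_mem hz _)
  · intro z w _ _ hz hw
    convert add_mem hz hw using 1
    noncomm_ring
  · intro r z hz h
    have e : r * z * x i - x i * (r * z) = r * (z * x i - x i * z) +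
      (r * x i - x i * r) * z := by noncomm_ring
    rw [e]
    exact add_mem (Ideal.mul_mem_left _ r h) (mem_localSat_of_mem_commFil
      (hP.anti (by omega) (hP.mul_mem (hP.comm_mem_two r (x i)) hz)))
  · intro r z hz hr h
    refine mem_localSat_of_mul_mem (hP.comm_mem hz _) hr ?_
    have e : r * (z * x i - x i * z) = r * z * x i - x i * (r * z) -
      (r * x i - x i * r) * z := by noncomm_ring
    rw [e]
    exact sub_mem h (mem_localSat_of_mem_commFil
      (hP.anti (by omega) (hP.mul_mem (hP.comm_mem_two r (x i)) hz)))

lemma exists_mul_comm_sub_sum_mem (hπ : IsAbelianization π) (hx : ∀ i, π (x i) = C.x i) {m : ℕ}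
    {z : R} (h1 : ∀ a ∈ commFiltration R 2, ∀ b, a * (z * b - b * z) ∈ commFiltration R m)
    (h2 : ∀ a ∈ commFiltration R 2, z * a - a * z ∈ commFiltration R m)
    (h3 : ∀ a b, (z * a - a * z) * b - b * (z * a - a * z) ∈ commFiltration R m) (b : R) :
    ∃ h, π h ∉ p ∧ ∃ c : Fin k → R,
      h * (z * b - b * z) - ∑ i, c i * (z * x i - x i * z) ∈ commFiltration R m := by
  obtain ⟨h, hh, c, e⟩ := C.exists_smul_eq (π b)
  obtain ⟨h, rfl⟩ := hπ.1 h
  choose c' hc' using fun i => hπ.1 (c i)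
  simp only [← hc', ← hx] at e
  exact ⟨h, hh, c', mul_comm_sub_sum_mem hπ h1 h2 h3 e⟩

lemma comm_mem_formSat_two (hπ : IsAbelianization π) (hx : ∀ i, π (x i) = C.x i) (z b : R) :
    z * b - b * z ∈ E.formSat x 2 := by
  have hP := isCommFiltration_commFil R
  have key (z b : R) (h : ∀ i, z * x i - x i * z ∈ E.formSat x 2) :
      z * b - b * z ∈ E.formSat x 2 := by
    obtain ⟨r, hr, c, hc⟩ := exists_mul_comm_sub_sum_mem (m := 3) hπ hx (z := z)
      (fun a ha b => commFiltration_anti (by omega) (hP.mul_mem ha (hP.comm_mem_two z b)))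
      (fun a ha => by
        rw [← neg_sub]
        exact neg_mem (hP.comm_mem ha z))
      (fun a b => hP.comm_mem (hP.comm_mem_two z a) b) b
    refine mem_localSat_of_mul_mem (hP.comm_mem_two z b) hr ?_
    rw [← sub_add_cancel (r * _) (∑ i, c i * (z * x i - x i * z))]
    exact add_mem (mem_localSat_of_mem_commFil hc)
      (sum_mem fun i _ => Ideal.mul_mem_left _ _ (h i))
  refine key z b fun i => ?_
  rw [← neg_sub]
  refine neg_mem (key _ _ fun j => ?_)
  simpa only [map_sub, map_mul, evalFree_single_of] using
    E.evalFree_mem_formSat (E.comm_gen_mem_leadForms hx i j)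

lemma comm_mem_formSat (hπ : IsAbelianization π) (hx : ∀ i, π (x i) = C.x i) {n : ℕ} {z : R}
    (hz : z ∈ E.formSat x n) (b : R) : z * b - b * z ∈ E.formSat x (n + 1) := by
  have hP := isCommFiltration_commFil R
  have hz' := E.formSat_le hz
  obtain ⟨r, hr, c, hc⟩ := exists_mul_comm_sub_sum_mem (m := n + 2) hπ hx (z := z)
    (fun a ha b => commFiltration_anti (by omega) (hP.mul_mem ha (hP.comm_mem hz' b)))
    (fun a ha => comm_mem_add_two hz' ha)
    (fun a b => hP.comm_mem (hP.comm_mem hz' a) b) b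
  refine mem_localSat_of_mul_mem (hP.comm_mem hz' b) hr ?_
  rw [← sub_add_cancel (r * _) (∑ i, c i * (z * x i - x i * z))]
  exact add_mem (mem_localSat_of_mem_commFil hc)
    (sum_mem fun i _ => Ideal.mul_mem_left _ _ (E.comm_gen_mem_formSat hx hz i))

lemma lieLCS_le_formSat (hπ : IsAbelianization π) (hx : ∀ i, π (x i) = C.x i) {i : ℕ} {a : R}
    (ha : a ∈ lieLCS R (i + 1)) : a ∈ E.formSat x (i + 2) := by
  induction i generalizing a with
  | zero =>
    induction ha using Submodule.span_induction with
    | zero => exact zero_mem _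
    | add a b _ _ ha hb => exact add_mem ha hb
    | smul c a _ ha =>
      rw [Algebra.smul_def]
      exact Ideal.mul_mem_left _ _ ha
    | mem a ha =>
      obtain ⟨u, -, v, rfl⟩ := ha
      exact E.comm_mem_formSat_two hπ hx u v
  | succ i ih =>
    induction ha using Submodule.span_induction with
    | zero => exact zero_mem _
    | add a b _ _ ha hb => exact add_mem ha hb
    | smul c a _ ha =>
      rw [Algebra.smul_def]
      exact Ideal.mul_mem_left _ _ ha
    | mem a ha =>
      obtain ⟨u, hu, v, rfl⟩ := ha
      exact E.comm_mem_formSat hπ hx (ih hu) v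

lemma mem_formSat (hπ : IsAbelianization π) (hx : ∀ i, π (x i) = C.x i) {n : ℕ} {z : R}
    (hz : z ∈ commFiltration R n) : z ∈ E.formSat x n := by
  induction hz using commFiltration_induction with
  | zero => exact zero_mem _
  | add z w _ _ hz hw => exact add_mem hz hw
  | neg z _ hz => exact neg_mem hz
  | prod N z hN hz =>
    rcases hN.lt_or_eq with h | rfl
    · exact mem_localSat_of_mem_commFil (commFiltration_anti h hz.mem)
    clear hN
    induction hz with
    | base r => exact E.mem_formSat_zero r
    | cons r ha _ ih =>
      exact E.mul_mem_formSat (Ideal.mul_mem_left _ r (E.lieLCS_le_formSat hπ hx ha)) ih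

end Expansion

end NCGeom

namespace NCGeom

variable {R : Type} [Ring R] [Algebra ℂ R] {S : Type} [CommRing S] [Algebra ℂ S]

/-- Linear independence over `ℂ` persists after extension of scalars. -/
lemma eq_zero_of_sum_mul_algebraMap_eq_zero {A : Type} [CommRing A] [Algebra ℂ A] {k : ℕ}
    {ι : Type} {b : ι → FreeAlg ℂ k} (hb : LinearIndependent ℂ b) {t : Finset ι} {c : ι → A}
    (h : ∀ w, ∑ j ∈ t, c j * algebraMap ℂ A ((b j).coeff w) = 0) {j : ι} (hj : j ∈ t) :
    c j = 0 := by
  refine (Module.forall_dual_apply_eq_zero_iff ℂ (c j)).1 fun f => ?_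
  refine linearIndependent_iff'.1 hb t (fun j => f (c j)) ?_ j hj
  ext w
  have := congrArg f (h w)
  simp only [map_sum, map_zero, mul_comm (c _), ← Algebra.smul_def, map_smul, smul_eq_mul] at this
  rw [MonoidAlgebra.coeff_sum, Finsupp.finsetSum_apply]
  simpa [mul_comm] using this

namespace Expansion

variable {π : R →ₐ[ℂ] S} {p : Ideal S} [p.IsPrime] {k : ℕ} {C : LocalCoords p k} {M : ℕ}
  (E : Expansion π C M) {x : Fin k → R}

/-- A combination of values of leading forms without terms of degree `n` has weight `n + 1`
locally. -/
lemma mem_localSat_bot_of_hom_mem (hπ : IsAbelianization π) {n : ℕ} (hM : n + 1 ≤ M) {u : R}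
    (hu : u ∈ Ideal.span (evalFree x '' E.leadForms x n))
    (hE : E.hom u ∈ truncFil _ _ M (n + 1)) : u ∈ localSat π p n ⊥ := by
  have hT := isCommFiltration_truncFil (A := Localization.AtPrime p) (k := k) M
  let b := Module.Basis.ofVectorSpace ℂ (E.leadForms x n)
  have hspan : Ideal.span (evalFree x '' E.leadForms x n) ≤
      Submodule.span R (Set.range fun j => evalFree x (b j : FreeAlg ℂ k)) := by
    refine Submodule.span_le.2 ?_
    rintro _ ⟨f, hf, rfl⟩
    have := congrArg (fun g : E.leadForms x n => evalFree x (g : FreeAlg ℂ k))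
      (b.linearCombination_repr ⟨f, hf⟩)
    dsimp only at this
    rw [← this, Finsupp.linearCombination_apply, Finsupp.sum, AddSubmonoidClass.coe_finsetSum,
      map_sum]
    refine sum_mem fun j _ => ?_
    rw [Submodule.coe_smul, map_smul, Algebra.smul_def]
    exact Submodule.smul_mem _ _ (Submodule.subset_span ⟨j, rfl⟩)
  obtain ⟨ρ, rfl⟩ := Finsupp.mem_span_range_iff_exists_finsupp.1 (hspan hu)
  let g : FreeAlg (Localization.AtPrime p) k := ∑ j ∈ ρ.support,
    MonoidAlgebra.single 1 (algebraMap S _ (π (ρ j))) * baseChange _ k (b j : FreeAlg ℂ k)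
  have hg : g ∈ ordGE (Localization.AtPrime p) k (n + 1) := by
    refine mem_ordGE_of_mk_mem hM ?_
    rw [← sub_sub_cancel (E.hom (ρ.sum fun j r => r • evalFree x (b j : FreeAlg ℂ k)))
      (Ideal.Quotient.mk _ g)]
    refine sub_mem hE ?_
    rw [Finsupp.sum, map_sum, map_sum, ← Finset.sum_sub_distrib]
    refine sum_mem fun j _ => ?_
    have h1 := hT.mul_mem (E.hom_sub_single_mem (ρ j)) (E.hom_mem (b j).2.2.1)
    have h2 := hT.mul_mem_left (Ideal.Quotient.mk _ (MonoidAlgebra.single 1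
      (algebraMap S _ (π (ρ j))))) (b j).2.2.2
    convert add_mem (add_comm 1 n ▸ h1) h2 using 1
    rw [smul_eq_mul, map_mul, map_mul]
    noncomm_ring
  have hρ (j) (hj : j ∈ ρ.support) : algebraMap S (Localization.AtPrime p) (π (ρ j)) = 0 := by
    refine eq_zero_of_sum_mul_algebraMap_eq_zero (b := fun j => (b j : FreeAlg ℂ k))
      (b.linearIndependent.map' (E.leadForms x n).subtype (Submodule.ker_subtype _))
      (t := ρ.support) (c := fun j => algebraMap S (Localization.AtPrime p) (π (ρ j)))
      (fun w => ?_) hj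
    by_cases hw : w.length = n
    · have := hg w (by omega)
      rw [MonoidAlgebra.coeff_sum, Finsupp.finsetSum_apply] at this
      simpa only [MonoidAlgebra.coeff_single_one_mul, MonoidAlgebra.coeff_mapRingHom] using this
    · refine Finset.sum_eq_zero fun j _ => ?_
      rw [(b j).2.1 w hw, map_zero, mul_zero]
  refine sum_mem fun j hj => ?_
  obtain ⟨⟨s, hs⟩, e⟩ := (IsLocalization.map_eq_zero_iff p.primeCompl _ _).1 (hρ j hj)
  obtain ⟨r, rfl⟩ := hπ.1 s
  have hP := isCommFiltration_commFil R
  have hb : evalFree x (b j : FreeAlg ℂ k) ∈ commFil R n := (b j).2.2.1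
  refine mem_localSat_of_mul_mem (hP.mul_mem_left _ hb) hs (mem_localSat_of_mem_commFil ?_)
  change r * (ρ j * _) ∈ _
  rw [← mul_assoc]
  have h2 : r * ρ j ∈ commFil R 2 := (hπ.2 _).1 (by rw [map_mul]; exact e)
  exact hP.anti (by omega) (hP.mul_mem h2 hb)

include E in
lemma mem_localSat_bot (hπ : IsAbelianization π) (hx : ∀ i, π (x i) = C.x i) (hk : 2 ≤ k) {n : ℕ}
    (hn : 1 ≤ n) (hM : n + 2 ≤ M) {z : R} (hz : z ∈ commFiltration R n)
    (hc : ∀ i, z * x i - x i * z ∈ commFiltration R (n + 2)) : z ∈ localSat π p n ⊥ := by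
  have hP := isCommFiltration_commFil R
  have hT := isCommFiltration_truncFil (A := Localization.AtPrime p) (k := k) M
  obtain ⟨-, h, hh, hhz⟩ := E.mem_formSat hπ hx hz
  obtain ⟨u, hu, v, hv, e⟩ := Submodule.mem_sup.1 hhz
  have hv : v ∈ commFiltration R (n + 1) := TwoSidedIdeal.mem_asIdeal.1 hv
  have h1 := E.hom_sub_mem_of_comm hk hn hM hx 0 (by simpa using E.hom_mem hz) hc
  rw [MonoidAlgebra.single_zero, map_zero, sub_zero] at h1
  refine mem_localSat_of_mul_mem hz hh ?_
  rw [← e]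
  refine add_mem (E.mem_localSat_bot_of_hom_mem hπ (by omega) hu ?_)
    (mem_localSat_of_mem_commFil hv)
  rw [eq_sub_of_add_eq e, map_sub, map_mul]
  exact sub_mem (hT.mul_mem_left _ h1) (E.hom_mem hv)

end Expansion

/-- An element lies in a step of the commutator filtration if it does so locally. -/
lemma mem_commFiltration_succ_of_localSat {π : R →ₐ[ℂ] S} (hπ : IsAbelianization π) {n : ℕ} {z : R}
    (hz : z ∈ commFiltration R n)
    (h : ∀ (p : Ideal S) [p.IsMaximal], z ∈ localSat π p n ⊥) : z ∈ commFiltration R (n + 1) := by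
  have hP := isCommFiltration_commFil R
  let T : Ideal S :=
    { carrier := {s | ∃ r, π r = s ∧ r * z ∈ commFil R (n + 1)}
      add_mem' := by
        rintro _ _ ⟨a, rfl, ha⟩ ⟨b, rfl, hb⟩
        exact ⟨a + b, map_add _ _ _, by rw [add_mul]; exact add_mem ha hb⟩
      zero_mem' := ⟨0, map_zero _, by simp⟩
      smul_mem' := by
        rintro s _ ⟨a, rfl, ha⟩
        obtain ⟨b, rfl⟩ := hπ.1 s
        exact ⟨b * a, map_mul _ _ _, by rw [mul_assoc]; exact hP.mul_mem_left _ ha⟩ }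
  have hT : T = ⊤ := by
    by_contra hT
    obtain ⟨p, hp, hTp⟩ := Ideal.exists_le_maximal T hT
    obtain ⟨-, r, hr, hrz⟩ := h p
    rw [bot_sup_eq, TwoSidedIdeal.mem_asIdeal] at hrz
    exact hr (hTp ⟨r, rfl, hrz⟩)
  obtain ⟨r, hr, hrz⟩ := (Ideal.eq_top_iff_one T).1 hT
  have h2 : 1 - r ∈ commFil R 2 := (hπ.2 _).1 (by rw [map_sub, map_one, hr, sub_self])
  have := add_mem (hP.anti (by omega) (hP.mul_mem h2 hz)) hrz
  rwa [sub_mul, one_mul, sub_add_cancel] at this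

end NCGeom

namespace NCGeom

variable {R : Type} [Ring R] [Algebra ℂ R] {S : Type} [CommRing S] [Algebra ℂ S]
  [Algebra.FiniteType ℂ S] [ConnectedSpace (PrimeSpectrum S)] {π : R →ₐ[ℂ] S}

/-- An element of weight `n` whose commutators have weight `n + 2` has weight `n + 1`. -/
lemma mem_commFiltration_succ_of_comm_mem (hsm : IsNCSmooth R) (hπ : IsAbelianization π)
    (hdim : 2 ≤ ringKrullDim S) {n : ℕ} (hn : 1 ≤ n) {z : R} (hz : z ∈ commFiltration R n)
    (hc : ∀ b, z * b - b * z ∈ commFiltration R (n + 2)) : z ∈ commFiltration R (n + 1) := by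
  have := hsm.formallySmooth hπ
  refine mem_commFiltration_succ_of_localSat hπ hz fun p _ => ?_
  obtain ⟨k, hk, ⟨C⟩⟩ := exists_localCoords_two_le hdim p
  choose x hx using fun i => hπ.1 (C.x i)
  obtain ⟨E⟩ := hsm.exists_expansion (π := π) C n
  exact E.mem_localSat_bot hπ hx hk hn le_rfl hz fun i => hc (x i)

/-- A function on `R^{ab}` that lifts to an element whose commutators have weight three has
vanishing differential. -/
lemma D_eq_zero_of_comm_mem (hsm : IsNCSmooth R) (hπ : IsAbelianization π)
    (hdim : 2 ≤ ringKrullDim S) {z : R} (hc : ∀ b, z * b - b * z ∈ commFiltration R 3) :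
    KaehlerDifferential.D ℂ S (π z) = 0 := by
  classical
  have := hsm.formallySmooth hπ
  suffices h : LinearMap.ker (LinearMap.toSpanSingleton S _ (KaehlerDifferential.D ℂ S (π z))) = ⊤ by
    simpa using (Ideal.eq_top_iff_one _).1 h
  by_contra hT
  obtain ⟨p, hp, hTp⟩ := Ideal.exists_le_maximal _ hT
  obtain ⟨k, hk, ⟨C⟩⟩ := exists_localCoords_two_le hdim p
  choose x hx using fun i => hπ.1 (C.x i)
  obtain ⟨E⟩ := hsm.exists_expansion (π := π) C 1
  have h1 := E.hom_sub_mem_of_comm hk le_rfl le_rfl hx _ (E.hom_sub_single_mem z)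
    fun i => hc (x i)
  have h2 := sub_mem h1 (E.hom_sub_mem z)
  rw [sub_sub_sub_cancel_left, ← map_sub, LocalCoords.linearPart, add_sub_cancel_left] at h2
  have h3 := mem_ordGE_of_mk_mem (by omega) h2
  obtain ⟨h, hh, e⟩ := C.exists_smul_D_eq_zero (f := π z) fun i => by
    have := h3 (.of i) (by simp)
    rw [MonoidAlgebra.coeff_sum, Finsupp.finsetSum_apply, Finset.sum_eq_single i] at this
    · simpa using this
    · intro j _ hj
      rw [MonoidAlgebra.coeff_single, Finsupp.single_apply, if_neg]
      exact fun h => hj (FreeMonoid.of_injective h)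
    · simp
  exact hh (hTp (by simpa using e))

/-- An element that is central up to weight `d + 2` is a scalar up to weight `d + 1`. -/
lemma exists_sub_algebraMap_mem (hsm : IsNCSmooth R) (hπ : IsAbelianization π)
    (hdim : 2 ≤ ringKrullDim S) {d : ℕ} (hd : 1 ≤ d) {z : R}
    (hc : ∀ b, z * b - b * z ∈ commFiltration R (d + 2)) :
    ∃ c : ℂ, z - algebraMap ℂ R c ∈ commFiltration R (d + 1) := by
  have := hsm.formallySmooth hπ
  obtain ⟨c, hc'⟩ := exists_eq_algebraMap_of_D_eq_zero
    (D_eq_zero_of_comm_mem hsm hπ hdim fun b => commFiltration_anti (by omega) (hc b))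
  refine ⟨c, ?_⟩
  suffices h : ∀ j, 1 ≤ j → j ≤ d → z - algebraMap ℂ R c ∈ commFiltration R (j + 1) from
    h d hd le_rfl
  intro j hj
  induction j, hj using Nat.le_induction with
  | base => exact fun _ => (hπ.2 _).1 (by rw [map_sub, hc', AlgHom.commutes, sub_self])
  | succ j _ ih =>
    intro hjd
    refine mem_commFiltration_succ_of_comm_mem hsm hπ hdim (by omega) (ih (by omega)) fun b => ?_
    rw [sub_mul, mul_sub, Algebra.commutes, sub_sub_sub_cancel_right]
    exact commFiltration_anti (by omega) (hc b)

end NCGeom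

namespace NCGeom

variable {R : Type} [Ring R] [Algebra ℂ R]

/-- A Cauchy sequence of units of an NC-complete algebra converges to a unit. -/
lemma IsNCComplete.exists_unit (hR : IsNCComplete R) {v : ℕ → Rˣ}
    (hv : ∀ n, (v (n + 1) - v n : R) ∈ commFiltration R n) :
    ∃ w : Rˣ, ∀ n, (w - v n : R) ∈ commFiltration R n ∧
      (↑w⁻¹ - ↑(v n)⁻¹ : R) ∈ commFiltration R n := by
  have hP := isCommFiltration_commFil R
  obtain ⟨y, hy⟩ := hR.2 (fun n => (v n : R)) hv
  obtain ⟨y', hy'⟩ := hR.2 (fun n => (↑(v n)⁻¹ : R)) fun n => by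
    have := neg_mem (hP.mul_mem_left (↑(v (n + 1))⁻¹ : R) (hP.mul_mem_right (hv n) (↑(v n)⁻¹ : R)))
    convert (show _ ∈ commFiltration R n from this) using 1
    rw [sub_mul, Units.mul_inv, mul_sub, mul_one, Units.inv_mul_cancel_left, neg_sub]
  refine ⟨⟨y, y', ?_, ?_⟩, fun n => ⟨hy n, hy' n⟩⟩
  · refine sub_eq_zero.1 (hR.1 _ fun n => ?_)
    have h := add_mem (hP.mul_mem_right (hy n) y') (hP.mul_mem_left (v n : R) (hy' n))
    convert (show _ ∈ commFiltration R n from h) using 1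
    rw [sub_mul, mul_sub, Units.mul_inv, sub_add_sub_cancel]
  · refine sub_eq_zero.1 (hR.1 _ fun n => ?_)
    have h := add_mem (hP.mul_mem_right (hy' n) y) (hP.mul_mem_left (↑(v n)⁻¹ : R) (hy n))
    convert (show _ ∈ commFiltration R n from h) using 1
    rw [sub_mul, mul_sub, Units.inv_mul, sub_add_sub_cancel]

lemma conj_sub_conj_mem {n : ℕ} {v w : Rˣ} (h : (v - w : R) ∈ commFiltration R n)
    (h' : (↑v⁻¹ - ↑w⁻¹ : R) ∈ commFiltration R n) (x : R) :
    ↑v * x * ↑v⁻¹ - ↑w * x * ↑w⁻¹ ∈ commFiltration R n := by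
  have hP := isCommFiltration_commFil R
  have h := add_mem (hP.mul_mem_right h (x * ↑v⁻¹)) (hP.mul_mem_left (↑w * x : R) h')
  convert (show _ ∈ commFiltration R n from h) using 1
  noncomm_ring

lemma comm_inv_mul_mem {n : ℕ} {v w : Rˣ}
    (h : ∀ x : R, ↑w * x * ↑w⁻¹ - ↑v * x * ↑v⁻¹ ∈ commFiltration R n) (x : R) :
    (↑(v⁻¹ * w) * x - x * ↑(v⁻¹ * w) : R) ∈ commFiltration R n := by
  have hP := isCommFiltration_commFil R
  have h := hP.mul_mem_left (↑v⁻¹ : R) (hP.mul_mem_right (h x) w)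
  convert (show _ ∈ commFiltration R n from h) using 1
  simp [sub_mul, mul_sub, mul_assoc]

lemma units_map_mul_comm (c : ℂˣ) (w : Rˣ) :
    Units.map (algebraMap ℂ R : ℂ →* R) c * w = w * Units.map (algebraMap ℂ R : ℂ →* R) c :=
  Units.ext (Algebra.commutes (c : ℂ) (w : R))

lemma conj_units_map_mul (c : ℂˣ) (w : Rˣ) (x : R) :
    (↑(Units.map (algebraMap ℂ R : ℂ →* R) c * w) * x *
      ↑(Units.map (algebraMap ℂ R : ℂ →* R) c * w)⁻¹ : R) = ↑w * x * ↑w⁻¹ := by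
  have h : (↑(Units.map (algebraMap ℂ R : ℂ →* R) c) * x : R) =
      x * ↑(Units.map (algebraMap ℂ R : ℂ →* R) c) := Algebra.commutes (c : ℂ) x
  rw [units_map_mul_comm, mul_inv_rev, Units.val_mul, Units.val_mul, mul_assoc (w : R), h,
    ← mul_assoc, ← mul_assoc, Units.mul_inv_cancel_right]

variable {S : Type} [CommRing S] [Algebra ℂ S]
  [Algebra.FiniteType ℂ S] [ConnectedSpace (PrimeSpectrum S)] {π : R →ₐ[ℂ] S}

/-- A unit that is central up to weight `d + 2` is a nonzero scalar up to weight `d + 1`. -/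
lemma exists_unit_sub_algebraMap_mem (hsm : IsNCSmooth R) (hπ : IsAbelianization π)
    (hdim : 2 ≤ ringKrullDim S) {d : ℕ} (hd : 1 ≤ d) {z : Rˣ}
    (hc : ∀ b : R, ↑z * b - b * ↑z ∈ commFiltration R (d + 2)) :
    ∃ c : ℂˣ, (z : R) - algebraMap ℂ R c ∈ commFiltration R (d + 1) := by
  obtain ⟨c, hc⟩ := exists_sub_algebraMap_mem hsm hπ hdim hd hc
  refine ⟨Units.mk0 c ?_, hc⟩
  rintro rfl
  have hz : π z = 0 := (hπ.2 _).2 (commFiltration_anti (by omega : 2 ≤ d + 1) (by simpa using hc))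
  obtain ⟨p⟩ := ConnectedSpace.toNonempty (α := PrimeSpectrum S)
  refine p.2.ne_top ((Ideal.eq_top_iff_one _).2 ?_)
  rw [← map_one π, ← Units.mul_inv z, map_mul, hz, zero_mul]
  exact zero_mem _

lemma exists_unit_of_compatible (hsm : IsNCSmooth R) (hπ : IsAbelianization π)
    (hdim : 2 ≤ ringKrullDim S) {u : ℕ → Rˣ}
    (hu : ∀ d (x : R), ↑(u (d + 1)) * x * ↑(u (d + 1))⁻¹ - ↑(u d) * x * ↑(u d)⁻¹ ∈
      commFiltration R (d + 2)) :
    ∃ v : Rˣ, ∀ d (x : R), ↑v * x * ↑v⁻¹ - ↑(u d) * x * ↑(u d)⁻¹ ∈ commFiltration R (d + 2) := by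
  have hP := isCommFiltration_commFil R
  choose c hc using fun n => exists_unit_sub_algebraMap_mem hsm hπ hdim (Nat.le_add_left 1 n)
    (comm_inv_mul_mem (hu (n + 1)))
  let s : ℂˣ →* Rˣ := Units.map (algebraMap ℂ R : ℂ →* R)
  let μ : ℕ → ℂˣ := fun n => ∏ j ∈ Finset.range n, c j
  obtain ⟨v, hv⟩ := hsm.1.exists_unit (v := fun n => s (μ n)⁻¹ * u (n + 1)) fun n => by
    have h := hP.anti (by omega : n ≤ n + 1 + 1)
      (hP.mul_mem_left (↑(s (μ (n + 1))⁻¹ * u (n + 1)) : R) (hc n))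
    convert (show _ ∈ commFiltration R n from h) using 1
    rw [mul_sub]
    congr 1
    · rw [← Units.val_mul]
      congr 1
      group
    · change _ = (↑(s (μ (n + 1))⁻¹ * u (n + 1)) * ↑(s (c n)) : R)
      rw [← Units.val_mul, mul_assoc, ← units_map_mul_comm, ← mul_assoc, ← map_mul,
        show μ (n + 1) = μ n * c n from Finset.prod_range_succ _ _, mul_inv_rev, mul_comm (c n)⁻¹,
        inv_mul_cancel_right]
  refine ⟨v, fun d x => ?_⟩
  have h1 := conj_sub_conj_mem (hv (d + 2)).1 (hv (d + 2)).2 x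
  rw [conj_units_map_mul] at h1
  have h2 (m : ℕ) (hm : d ≤ m) :
      ↑(u m) * x * ↑(u m)⁻¹ - ↑(u d) * x * ↑(u d)⁻¹ ∈ commFiltration R (d + 2) := by
    induction m, hm using Nat.le_induction with
    | base => simp
    | succ m hm ih =>
      rw [← sub_add_sub_cancel _ (↑(u m) * x * ↑(u m)⁻¹)]
      exact add_mem (commFiltration_anti (by omega) (hu m x)) ih
  rw [← sub_add_sub_cancel _ (↑(u (d + 2 + 1)) * x * ↑(u (d + 2 + 1))⁻¹)]
  exact add_mem h1 (h2 _ (by omega))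

end NCGeom

open NCGeom in
/-- Let `R` be an NC-smooth `ℂ`-algebra whose abelianization (presented
by `π : R → S`) is connected of Krull dimension `≥ 2`.  Then `R^* → lim_d InnAut(R/I_{d+2}R)`
is surjective, and consequently every automorphism of `R` inducing an inner automorphism of
each quotient `R/I_{d+2}R` is itself inner.

An element of `lim_d InnAut(R/I_{d+2}R)` is encoded by a sequence of units `u d ∈ R^*`
(every unit of `R/I_{d+2}R` lifts to a unit of `R`, since `R` is NC-complete) whose induced
conjugations on the quotients are compatible, i.e. conjugation by `u (d+1)` and by `u d`
agree modulo `I_{d+2}R`; an automorphism of `R/I_{d+2}R` is inner iff it is conjugation by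
some unit modulo `I_{d+2}R`. -/
theorem units_surject_onto_lim_innAut
    (R : Type) [Ring R] [Algebra ℂ R] (hsm : IsNCSmooth R)
    (S : Type) [CommRing S] [Algebra ℂ S] [Algebra.FiniteType ℂ S]
    (π : R →ₐ[ℂ] S) (hπ : IsAbelianization π)
    (hdim : 2 ≤ ringKrullDim S)
    (hconn : ConnectedSpace (PrimeSpectrum S)) :
    -- surjectivity of `R^* → lim_d InnAut(R/I_{d+2}R)`:
    (∀ u : ℕ → Rˣ,
      (∀ d : ℕ, ∀ x : R,
        ↑(u (d+1)) * x * ↑(u (d+1))⁻¹ - ↑(u d) * x * ↑(u d)⁻¹ ∈ commFiltration R (d + 2)) →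
      ∃ v : Rˣ, ∀ d : ℕ, ∀ x : R,
        ↑v * x * ↑v⁻¹ - ↑(u d) * x * ↑(u d)⁻¹ ∈ commFiltration R (d + 2)) ∧
    -- consequence: an automorphism of `R` which is inner on every quotient is inner:
    (∀ f : R ≃ₐ[ℂ] R,
      (∀ d : ℕ, ∃ u : Rˣ, ∀ x : R, f x - ↑u * x * ↑u⁻¹ ∈ commFiltration R (d + 2)) →
      ∃ u : Rˣ, ∀ x : R, f x = ↑u * x * ↑u⁻¹) := by
  refine ⟨fun u hu => exists_unit_of_compatible hsm hπ hdim hu, fun f hf => ?_⟩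
  choose u hu using hf
  obtain ⟨v, hv⟩ := exists_unit_of_compatible hsm hπ hdim (u := u) fun d x => by
    rw [← sub_sub_sub_cancel_left _ _ (f x)]
    exact sub_mem (hu d x) (commFiltration_anti (by omega) (hu (d + 1) x))
  refine ⟨v, fun x => sub_eq_zero.1 (hsm.1.1 _ fun n => commFiltration_anti (n.le_add_right 2) ?_)⟩
  rw [← sub_sub_sub_cancel_right _ _ (↑(u n) * x * ↑(u n)⁻¹)]
  exact sub_mem (hu n x) (hv n x)
end
end

section
/- Let X be a topological space, G a sheaf of groups on X, and E a sheaf of sets on X equipped with an action of G. Then the nonabelian hypercohomology set ℍ¹(X, G ⟳ E) is in natural bijection with the set of isomorphism classes of pairs (P, e), where P is a G-torsor on X and e is a global section of the twisted sheaf E_P = P ×_G E. -/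
noncomputable section

namespace NCGeom

open TopologicalSpace

variable (X : Type) [TopologicalSpace X]

/-- A sheaf of sets on a topological space `X`, given by its sections and restriction
maps, satisfying the (unique-gluing) sheaf condition. -/
structure SetSheaf : Type 1 where
  secs : Opens X → Type
  res : ∀ {U V : Opens X}, U ≤ V → secs V → secs U
  res_id : ∀ (U : Opens X) (s : secs U), res (le_refl U) s = s
  res_comp : ∀ {U V W : Opens X} (h1 : U ≤ V) (h2 : V ≤ W) (s : secs W),
    res h1 (res h2 s) = res (h1.trans h2) s
  glue : ∀ {ι : Type} (U : ι → Opens X) (s : ∀ i, secs (U i)),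
    (∀ i j, res (inf_le_left : U i ⊓ U j ≤ U i) (s i) =
            res (inf_le_right : U i ⊓ U j ≤ U j) (s j)) →
    ∃! t : secs (iSup U), ∀ i, res (le_iSup U i) t = s i

/-- A sheaf of groups on `X`. -/
structure SheafOfGroups extends SetSheaf X : Type 1 where
  [grp : ∀ U : Opens X, Group (secs U)]
  res_mul : ∀ {U V : Opens X} (h : U ≤ V) (a b : secs V), res h (a * b) = res h a * res h b

attribute [instance] SheafOfGroups.grp

variable {X}

/-- An action of a sheaf of groups `G` on a sheaf of sets `E`. -/
structure ActionOn (G : SheafOfGroups X) (E : SetSheaf X) : Type 1 where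
  act : ∀ U : Opens X, G.secs U → E.secs U → E.secs U
  act_one : ∀ (U : Opens X) (e : E.secs U), act U 1 e = e
  act_mul : ∀ (U : Opens X) (g g' : G.secs U) (e : E.secs U),
    act U (g * g') e = act U g (act U g' e)
  act_res : ∀ {U V : Opens X} (h : U ≤ V) (g : G.secs V) (e : E.secs V),
    E.res h (act V g e) = act U (G.res h g) (E.res h e)

/-- Čech data for the pair `G ⟳ E` over a family of opens `U`: sections
`g i j ∈ G(U_i ∩ U_j)` and `e i ∈ E(U_i)`. -/
structure CechData (G : SheafOfGroups X) (E : SetSheaf X) (ι : Type) (U : ι → Opens X) where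
  g : ∀ i j : ι, G.secs (U i ⊓ U j)
  e : ∀ i : ι, E.secs (U i)

/-- The 1-cocycle condition for Čech data: `g ii = 1`, `g ij · g ji = 1`,
`g ij · g jk = g ik` on triple intersections, and `e i = g ij · e j` on double
intersections. -/
def IsCocycle {G : SheafOfGroups X} {E : SetSheaf X} (ρ : ActionOn G E)
    {ι : Type} {U : ι → Opens X} (c : CechData G E ι U) : Prop :=
  (∀ i, c.g i i = 1) ∧
  (∀ i j, c.g i j * G.res (le_inf inf_le_right inf_le_left) (c.g j i) = 1) ∧
  (∀ i j k, G.res (inf_le_left : U i ⊓ U j ⊓ U k ≤ U i ⊓ U j) (c.g i j) *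
      G.res (le_inf (inf_le_left.trans inf_le_right) inf_le_right :
        U i ⊓ U j ⊓ U k ≤ U j ⊓ U k) (c.g j k) =
      G.res (le_inf (inf_le_left.trans inf_le_left) inf_le_right :
        U i ⊓ U j ⊓ U k ≤ U i ⊓ U k) (c.g i k)) ∧
  (∀ i j, E.res (inf_le_left : U i ⊓ U j ≤ U i) (c.e i) =
    ρ.act (U i ⊓ U j) (c.g i j) (E.res (inf_le_right : U i ⊓ U j ≤ U j) (c.e j)))

/-- Restriction of Čech data along a refinement `W k ≤ U (a k)` of covers. -/
def CechData.restrict {G : SheafOfGroups X} {E : SetSheaf X} {ι : Type} {U : ι → Opens X}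
    (c : CechData G E ι U) {κ : Type} (W : κ → Opens X) (a : κ → ι)
    (ha : ∀ k, W k ≤ U (a k)) : CechData G E κ W where
  g := fun k l => G.res
    (le_inf (inf_le_left.trans (ha k)) (inf_le_right.trans (ha l))) (c.g (a k) (a l))
  e := fun k => E.res (ha k) (c.e (a k))

/-- Two Čech data over the same cover are cohomologous if they differ by a Čech
0-cochain `h`: `g'_{ij} = h_i g_{ij} h_j⁻¹` and `e'_i = h_i(e_i)`. -/
def Cohomologous {G : SheafOfGroups X} {E : SetSheaf X} (ρ : ActionOn G E)
    {ι : Type} {U : ι → Opens X} (c c' : CechData G E ι U) : Prop :=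
  ∃ h : ∀ i, G.secs (U i),
    (∀ i j, c'.g i j =
      G.res inf_le_left (h i) * c.g i j * (G.res inf_le_right (h j))⁻¹) ∧
    (∀ i, c'.e i = ρ.act (U i) (h i) (c.e i))

/-- A 1-cocycle for `G ⟳ E` on some open cover of `X`. -/
structure GlobalCocycle (G : SheafOfGroups X) (E : SetSheaf X) (ρ : ActionOn G E) :
    Type 1 where
  ι : Type
  U : ι → Opens X
  covers : iSup U = ⊤
  c : CechData G E ι U
  isCocycle : IsCocycle ρ c

/-- Two global 1-cocycles are equivalent if they become cohomologous on a common
refinement of their covers; `ℍ¹(X, G ⟳ E)` is the quotient by this relation (the colimit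
of `ℍ¹(𝒰, G ⟳ E)` over refinements). -/
def CechRel {G : SheafOfGroups X} {E : SetSheaf X} (ρ : ActionOn G E)
    (c₁ c₂ : GlobalCocycle G E ρ) : Prop :=
  ∃ (κ : Type) (W : κ → Opens X) (_ : iSup W = ⊤)
    (a : κ → c₁.ι) (b : κ → c₂.ι)
    (ha : ∀ k, W k ≤ c₁.U (a k)) (hb : ∀ k, W k ≤ c₂.U (b k)),
    Cohomologous ρ (c₁.c.restrict W a ha) (c₂.c.restrict W b hb)

/-- The nonabelian hypercohomology set `ℍ¹(X, G ⟳ E)`. -/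
def H1 {G : SheafOfGroups X} {E : SetSheaf X} (ρ : ActionOn G E) : Type 1 :=
  Quot (CechRel ρ)

/-- A pair `(P, e)` consisting of a `G`-torsor `P` and a global section `e` of the twisted
sheaf `E_P = P ×_G E`; the section is encoded, equivalently, as a `G`-equivariant morphism
of sheaves `η : P → E`. -/
structure TorsorPair (G : SheafOfGroups X) (E : SetSheaf X) (ρ : ActionOn G E) :
    Type 1 where
  P : SetSheaf X
  act : ∀ U : Opens X, G.secs U → P.secs U → P.secs U
  act_one : ∀ U e, act U 1 e = e
  act_mul : ∀ U g g' e, act U (g * g') e = act U g (act U g' e)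
  act_res : ∀ {U V : Opens X} (h : U ≤ V) (g : G.secs V) (s : P.secs V),
    P.res h (act V g s) = act U (G.res h g) (P.res h s)
  /-- `P` is a `G`-torsor: locally, `P` is equivariantly isomorphic to `G` acting on
  itself by left translations. -/
  locally_trivial : ∀ x : X, ∃ (U : Opens X) (_ : x ∈ U)
    (φ : ∀ (V : Opens X) (_ : V ≤ U), P.secs V ≃ G.secs V),
    (∀ (V : Opens X) (hV : V ≤ U) (g : G.secs V) (s : P.secs V),
      φ V hV (act V g s) = g * φ V hV s) ∧
    (∀ (V V' : Opens X) (hV : V ≤ U) (h : V' ≤ V) (s : P.secs V),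
      G.res h (φ V hV s) = φ V' (h.trans hV) (P.res h s))
  /-- the global section of `E_P`, as an equivariant morphism `P → E`. -/
  η : ∀ U : Opens X, P.secs U → E.secs U
  η_res : ∀ {U V : Opens X} (h : U ≤ V) (s : P.secs V), E.res h (η V s) = η U (P.res h s)
  η_equiv : ∀ (U : Opens X) (g : G.secs U) (s : P.secs U),
    η U (act U g s) = ρ.act U g (η U s)

/-- Isomorphism of pairs `(P, e) ≅ (P', e')`: an equivariant isomorphism of sheaves
`P ≅ P'` commuting with the sections. -/
def PairRel {G : SheafOfGroups X} {E : SetSheaf X} {ρ : ActionOn G E}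
    (T T' : TorsorPair G E ρ) : Prop :=
  ∃ χ : ∀ U : Opens X, T.P.secs U → T'.P.secs U,
    (∀ U, Function.Bijective (χ U)) ∧
    (∀ {U V : Opens X} (h : U ≤ V) (s : T.P.secs V),
      T'.P.res h (χ V s) = χ U (T.P.res h s)) ∧
    (∀ (U : Opens X) (g : G.secs U) (s : T.P.secs U),
      χ U (T.act U g s) = T'.act U g (χ U s)) ∧
    (∀ (U : Opens X) (s : T.P.secs U), T'.η U (χ U s) = T.η U s)

end NCGeom

namespace NCGeom

open TopologicalSpace

variable {X : Type} [TopologicalSpace X]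

namespace SetSheaf

variable (F : SetSheaf X) {ι : Type} {U : ι → Opens X} {V : Opens X}

theorem ext_of_cover (hU : ∀ i, U i ≤ V) (hV : V ≤ iSup U) {s t : F.secs V}
    (h : ∀ i, F.res (hU i) s = F.res (hU i) t) : s = t := by
  obtain rfl : V = iSup U := le_antisymm hV (iSup_le hU)
  refine (F.glue U (fun i => F.res (hU i) t) fun i j => ?_).unique h fun i => rfl
  simp only [F.res_comp]

theorem exists_glue (hU : ∀ i, U i ≤ V) (hV : V ≤ iSup U) (s : ∀ i, F.secs (U i))
    (hs : ∀ i j, F.res (inf_le_left : U i ⊓ U j ≤ U i) (s i) =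
      F.res (inf_le_right : U i ⊓ U j ≤ U j) (s j)) :
    ∃ t : F.secs V, ∀ i, F.res (hU i) t = s i := by
  obtain rfl : V = iSup U := le_antisymm hV (iSup_le hU)
  exact (F.glue U s hs).exists

end SetSheaf

theorem le_iSup_inf_of_covers {ι : Type} {U : ι → Opens X} (hU : iSup U = ⊤) (V : Opens X) :
    V ≤ ⨆ i, V ⊓ U i := by
  rw [← inf_iSup_eq, hU, inf_top_eq]

namespace SheafOfGroups

variable (G : SheafOfGroups X) {U V : Opens X}

theorem res_one (h : U ≤ V) : G.res h (1 : G.secs V) = 1 := by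
  have := G.res_mul h 1 1
  rwa [mul_one, left_eq_mul] at this

end SheafOfGroups

variable {G : SheafOfGroups X} {E : SetSheaf X} {ρ : ActionOn G E}

namespace TorsorPair

theorem iSup_eq_top {U : X → Opens X} (hU : ∀ x, x ∈ U x) : iSup U = ⊤ :=
  top_le_iff.1 fun x _ => Opens.mem_iSup.2 ⟨x, hU x⟩

theorem act_left_injective (T : TorsorPair G E ρ) {V : Opens X} (s : T.P.secs V)
    {g g' : G.secs V} (h : T.act V g s = T.act V g' s) : g = g' := by
  choose U hU φ hφ hφres using T.locally_trivial
  refine G.ext_of_cover (U := fun x => V ⊓ U x) (fun _ => inf_le_left)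
    (le_iSup_inf_of_covers (iSup_eq_top hU) V) fun x => ?_
  have h' := congrArg (fun t => φ x _ inf_le_right (T.P.res (inf_le_left : V ⊓ U x ≤ V) t)) h
  simpa only [T.act_res, hφ, mul_left_inj] using h'

theorem exists_act_eq (T : TorsorPair G E ρ) {V : Opens X} (s t : T.P.secs V) :
    ∃ g : G.secs V, T.act V g s = t := by
  choose U hU φ hφ hφres using T.locally_trivial
  have hloc : ∀ x, ∃ g : G.secs (V ⊓ U x),
      T.act _ g (T.P.res inf_le_left s) = T.P.res inf_le_left t := fun x => by
    refine ⟨φ x _ inf_le_right (T.P.res inf_le_left t) *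
      (φ x _ inf_le_right (T.P.res inf_le_left s))⁻¹, (φ x _ inf_le_right).injective ?_⟩
    rw [hφ, inv_mul_cancel_right]
  choose g hg using hloc
  have hcov := le_iSup_inf_of_covers (iSup_eq_top hU) V
  obtain ⟨γ, hγ⟩ := G.exists_glue (fun x => inf_le_left) hcov g fun x y => by
    refine T.act_left_injective (T.P.res (inf_le_left.trans inf_le_left) s) ?_
    have hx := congrArg (T.P.res (inf_le_left : V ⊓ U x ⊓ (V ⊓ U y) ≤ _)) (hg x)
    have hy := congrArg (T.P.res (inf_le_right : V ⊓ U x ⊓ (V ⊓ U y) ≤ _)) (hg y)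
    simp only [T.act_res, T.P.res_comp] at hx hy
    exact hx.trans hy.symm
  refine ⟨γ, T.P.ext_of_cover (fun x => inf_le_left) hcov fun x => ?_⟩
  rw [T.act_res, hγ, hg]

/-- The torsor pair `T` is described by the Čech data `c`: there are sections `p i` of `T.P`
over `U i` with transition functions `c.g` and with images `c.e` in `E`. -/
def IsDescribedBy (T : TorsorPair G E ρ) {ι : Type} {U : ι → Opens X}
    (c : CechData G E ι U) : Prop :=
  ∃ p : ∀ i, T.P.secs (U i),
    (∀ i j, T.P.res (inf_le_left : U i ⊓ U j ≤ U i) (p i) =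
      T.act _ (c.g i j) (T.P.res inf_le_right (p j))) ∧
    ∀ i, T.η _ (p i) = c.e i

theorem IsDescribedBy.restrict {T : TorsorPair G E ρ} {ι : Type} {U : ι → Opens X}
    {c : CechData G E ι U} (hc : T.IsDescribedBy c) {κ : Type} (W : κ → Opens X) (a : κ → ι)
    (ha : ∀ k, W k ≤ U (a k)) : T.IsDescribedBy (c.restrict W a ha) := by
  obtain ⟨p, hp, he⟩ := hc
  refine ⟨fun k => T.P.res (ha k) (p (a k)), fun k l => ?_, fun k => ?_⟩
  · have h := congrArg (T.P.res (le_inf (inf_le_left.trans (ha k)) (inf_le_right.trans (ha l)) :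
      W k ⊓ W l ≤ U (a k) ⊓ U (a l))) (hp (a k) (a l))
    simpa only [CechData.restrict, T.act_res, T.P.res_comp] using h
  · rw [← T.η_res, he]
    rfl

theorem IsDescribedBy.of_cohomologous {T : TorsorPair G E ρ} {ι : Type} {U : ι → Opens X}
    {c c' : CechData G E ι U} (hc : T.IsDescribedBy c) (h : Cohomologous ρ c c') :
    T.IsDescribedBy c' := by
  obtain ⟨p, hp, he⟩ := hc
  obtain ⟨h, hg, he'⟩ := h
  refine ⟨fun i => T.act _ (h i) (p i), fun i j => ?_, fun i => ?_⟩
  · rw [T.act_res, T.act_res, hp, ← T.act_mul, ← T.act_mul, hg, inv_mul_cancel_right]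
  · rw [T.η_equiv, he, he']

theorem IsDescribedBy.of_pairRel {T T' : TorsorPair G E ρ} {ι : Type} {U : ι → Opens X}
    {c : CechData G E ι U} (hc : T.IsDescribedBy c) (h : PairRel T T') :
    T'.IsDescribedBy c := by
  obtain ⟨p, hp, he⟩ := hc
  obtain ⟨χ, -, hres, hact, hη⟩ := h
  refine ⟨fun i => χ _ (p i), fun i j => ?_, fun i => ?_⟩
  · rw [hres, hp, hact, hres]
  · rw [hη, he]

theorem IsDescribedBy.cohomologous {T : TorsorPair G E ρ} {ι : Type} {U : ι → Opens X}
    {c c' : CechData G E ι U} (hc : T.IsDescribedBy c) (hc' : T.IsDescribedBy c') :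
    Cohomologous ρ c c' := by
  obtain ⟨p, hp, he⟩ := hc
  obtain ⟨q, hq, he'⟩ := hc'
  choose h hh using fun i => T.exists_act_eq (p i) (q i)
  refine ⟨h, fun i j => ?_, fun i => ?_⟩
  · refine T.act_left_injective (T.P.res inf_le_right (q j)) ?_
    rw [← hq, ← hh, ← hh, T.act_res, T.act_res, ← T.act_mul, inv_mul_cancel_right, T.act_mul, hp]
  · rw [← he', ← hh, T.η_equiv, he]

theorem IsDescribedBy.cechRel {T : TorsorPair G E ρ} {c c' : GlobalCocycle G E ρ}
    (hc : T.IsDescribedBy c.c) (hc' : T.IsDescribedBy c'.c) : CechRel ρ c c' := by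
  refine ⟨c.ι × c'.ι, fun k => c.U k.1 ⊓ c'.U k.2, ?_, Prod.fst, Prod.snd,
    fun _ => inf_le_left, fun _ => inf_le_right, (hc.restrict _ _ _).cohomologous
      (hc'.restrict _ _ _)⟩
  rw [← iSup_inf_iSup, c.covers, c'.covers, inf_top_eq]

section Comparison

variable {T T' : TorsorPair G E ρ} {ι : Type} {U : ι → Opens X}

/-- Sections `s` of `T.P` and `t` of `T'.P` having the same coordinates with respect to the
local sections `p` and `q`. -/
def SameCoordinates (p : ∀ i, T.P.secs (U i)) (q : ∀ i, T'.P.secs (U i)) {V : Opens X}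
    (s : T.P.secs V) (t : T'.P.secs V) : Prop :=
  ∀ i, ∃ γ : G.secs (V ⊓ U i),
    T.P.res inf_le_left s = T.act _ γ (T.P.res inf_le_right (p i)) ∧
    T'.P.res inf_le_left t = T'.act _ γ (T'.P.res inf_le_right (q i))

variable {p : ∀ i, T.P.secs (U i)} {q : ∀ i, T'.P.secs (U i)} {V : Opens X}
  {s : T.P.secs V} {t : T'.P.secs V}

theorem SameCoordinates.symm (h : SameCoordinates p q s t) : SameCoordinates q p t s := fun i =>
  let ⟨γ, h₁, h₂⟩ := h i
  ⟨γ, h₂, h₁⟩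

theorem SameCoordinates.right_unique (hU : iSup U = ⊤) {t' : T'.P.secs V}
    (h : SameCoordinates p q s t) (h' : SameCoordinates p q s t') : t = t' := by
  refine T'.P.ext_of_cover (fun i => inf_le_left) (le_iSup_inf_of_covers hU V) fun i => ?_
  obtain ⟨γ, h₁, h₂⟩ := h i
  obtain ⟨γ', h₁', h₂'⟩ := h' i
  rw [h₂, h₂', T.act_left_injective _ (h₁.symm.trans h₁')]

theorem SameCoordinates.res (h : SameCoordinates p q s t) {W : Opens X} (hW : W ≤ V) :
    SameCoordinates p q (T.P.res hW s) (T'.P.res hW t) := fun i => by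
  obtain ⟨γ, h₁, h₂⟩ := h i
  have hWi : W ⊓ U i ≤ V ⊓ U i := inf_le_inf_right _ hW
  refine ⟨G.res hWi γ, ?_, ?_⟩
  · simpa only [T.act_res, T.P.res_comp] using congrArg (T.P.res hWi) h₁
  · simpa only [T'.act_res, T'.P.res_comp] using congrArg (T'.P.res hWi) h₂

theorem SameCoordinates.act (h : SameCoordinates p q s t) (g : G.secs V) :
    SameCoordinates p q (T.act V g s) (T'.act V g t) := fun i => by
  obtain ⟨γ, h₁, h₂⟩ := h i
  exact ⟨G.res inf_le_left g * γ, by rw [T.act_res, h₁, T.act_mul],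
    by rw [T'.act_res, h₂, T'.act_mul]⟩

theorem SameCoordinates.η_eq (hU : iSup U = ⊤) (he : ∀ i, T.η _ (p i) = T'.η _ (q i))
    (h : SameCoordinates p q s t) : T'.η V t = T.η V s := by
  refine E.ext_of_cover (fun i => inf_le_left) (le_iSup_inf_of_covers hU V) fun i => ?_
  obtain ⟨γ, h₁, h₂⟩ := h i
  rw [T.η_res, T'.η_res, h₁, h₂, T.η_equiv, T'.η_equiv, ← T.η_res, ← T'.η_res, he]

theorem exists_sameCoordinates (hU : iSup U = ⊤) {c : CechData G E ι U}
    (hp : ∀ i j, T.P.res (inf_le_left : U i ⊓ U j ≤ U i) (p i) =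
      T.act _ (c.g i j) (T.P.res inf_le_right (p j)))
    (hq : ∀ i j, T'.P.res (inf_le_left : U i ⊓ U j ≤ U i) (q i) =
      T'.act _ (c.g i j) (T'.P.res inf_le_right (q j))) (s : T.P.secs V) :
    ∃ t : T'.P.secs V, SameCoordinates p q s t := by
  choose γ hγ using fun i =>
    T.exists_act_eq (T.P.res (inf_le_right : V ⊓ U i ≤ U i) (p i)) (T.P.res inf_le_left s)
  obtain ⟨t, ht⟩ := T'.P.exists_glue (fun i => inf_le_left) (le_iSup_inf_of_covers hU V)
    (fun i => T'.act _ (γ i) (T'.P.res inf_le_right (q i))) fun i j => by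
      have hij : V ⊓ U i ⊓ (V ⊓ U j) ≤ U i ⊓ U j := inf_le_inf inf_le_right inf_le_right
      have hpij := congrArg (T.P.res hij) (hp i j)
      have hqij := congrArg (T'.P.res hij) (hq i j)
      have hi := congrArg (T.P.res (inf_le_left : V ⊓ U i ⊓ (V ⊓ U j) ≤ _)) (hγ i)
      have hj := congrArg (T.P.res (inf_le_right : V ⊓ U i ⊓ (V ⊓ U j) ≤ _)) (hγ j)
      simp only [T.act_res, T'.act_res, T.P.res_comp, T'.P.res_comp] at hpij hqij hi hj ⊢
      rw [hpij, ← hj, ← T.act_mul] at hi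
      rw [hqij, ← T'.act_mul, T.act_left_injective _ hi]
  exact ⟨t, fun i => ⟨γ i, (hγ i).symm, ht i⟩⟩

end Comparison

theorem IsDescribedBy.pairRel {T T' : TorsorPair G E ρ} {ι : Type} {U : ι → Opens X}
    (hU : iSup U = ⊤) {c : CechData G E ι U} (hc : T.IsDescribedBy c)
    (hc' : T'.IsDescribedBy c) : PairRel T T' := by
  obtain ⟨p, hp, he⟩ := hc
  obtain ⟨q, hq, he'⟩ := hc'
  choose χ hχ using fun (V : Opens X) (s : T.P.secs V) =>
    exists_sameCoordinates (q := q) hU hp hq s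
  refine ⟨χ, fun V => ⟨fun s s' h => ?_, fun t => ?_⟩,
    fun h s => ((hχ _ s).res h).right_unique hU (hχ _ _),
    fun V g s => (hχ _ _).right_unique hU ((hχ _ s).act g),
    fun V s => (hχ V s).η_eq hU fun i => (he i).trans (he' i).symm⟩
  · exact (hχ V s).symm.right_unique hU (h ▸ (hχ V s').symm)
  · obtain ⟨s, hs⟩ := exists_sameCoordinates (q := p) hU hq hp t
    exact ⟨s, (hχ V s).right_unique hU hs.symm⟩

theorem exists_isDescribedBy (T : TorsorPair G E ρ) :
    ∃ c : GlobalCocycle G E ρ, T.IsDescribedBy c.c := by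
  choose U hU φ _ _ using T.locally_trivial
  let p x : T.P.secs (U x) := (φ x (U x) le_rfl).symm 1
  choose g hg using fun x y =>
    T.exists_act_eq (T.P.res (inf_le_right : U x ⊓ U y ≤ U y) (p y)) (T.P.res inf_le_left (p x))
  refine ⟨⟨X, U, iSup_eq_top hU, ⟨g, fun x => T.η _ (p x)⟩, fun x => ?_, fun x y => ?_,
    fun x y z => ?_, fun x y => ?_⟩, p, fun x y => (hg x y).symm, fun x => rfl⟩
  · exact T.act_left_injective _ ((hg x x).trans (T.act_one _ _).symm)
  · refine T.act_left_injective (T.P.res inf_le_left (p x)) ?_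
    have h := congrArg (T.P.res (le_inf inf_le_right inf_le_left : U x ⊓ U y ≤ U y ⊓ U x)) (hg y x)
    simp only [T.act_res, T.P.res_comp] at h
    rw [T.act_mul, h, hg, T.act_one]
  · refine T.act_left_injective (T.P.res inf_le_right (p z)) ?_
    have hxy := congrArg (T.P.res (inf_le_left : U x ⊓ U y ⊓ U z ≤ _)) (hg x y)
    have hyz := congrArg (T.P.res (le_inf (inf_le_left.trans inf_le_right) inf_le_right :
        U x ⊓ U y ⊓ U z ≤ _)) (hg y z)
    have hxz := congrArg (T.P.res (le_inf (inf_le_left.trans inf_le_left) inf_le_right :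
        U x ⊓ U y ⊓ U z ≤ _)) (hg x z)
    simp only [T.act_res, T.P.res_comp] at hxy hyz hxz
    rw [T.act_mul, hyz, hxy, hxz]
  · rw [T.η_res, T.η_res, ← hg, T.η_equiv]

end TorsorPair

namespace GlobalCocycle

variable (c : GlobalCocycle G E ρ)

theorem res_g_mul_res_g {W : Opens X} {i j k : c.ι} (hi : W ≤ c.U i) (hj : W ≤ c.U j)
    (hk : W ≤ c.U k) :
    G.res (le_inf hi hj) (c.c.g i j) * G.res (le_inf hj hk) (c.c.g j k) =
      G.res (le_inf hi hk) (c.c.g i k) := by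
  have h := congrArg (G.res (le_inf (le_inf hi hj) hk)) (c.isCocycle.2.2.1 i j k)
  simpa only [G.res_mul, G.res_comp] using h

theorem res_e {W : Opens X} {i j : c.ι} (hi : W ≤ c.U i) (hj : W ≤ c.U j) :
    E.res hi (c.c.e i) = ρ.act W (G.res (le_inf hi hj) (c.c.g i j)) (E.res hj (c.c.e j)) := by
  have h := congrArg (E.res (le_inf hi hj)) (c.isCocycle.2.2.2 i j)
  simpa only [ρ.act_res, E.res_comp] using h

/-- Families of coordinates `γ i` over `V ⊓ U i` defining a section over `V` of the torsor
glued from the cocycle `c`. -/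
def TorsorSections (V : Opens X) : Type :=
  {γ : ∀ i, G.secs (V ⊓ c.U i) // ∀ (W : Opens X) (hV : W ≤ V) (i j : c.ι) (hi : W ≤ c.U i)
    (hj : W ≤ c.U j), G.res (le_inf hV hj) (γ j) =
      G.res (le_inf hV hi) (γ i) * G.res (le_inf hi hj) (c.c.g i j)}

/-- The sheaf of sets underlying the torsor glued from the cocycle `c`. -/
def torsorSheaf : SetSheaf X where
  secs := c.TorsorSections
  res {W V} h γ := ⟨fun i => G.res (inf_le_inf_right _ h) (γ.1 i), fun W' hV i j hi hj => by
    simpa only [G.res_comp] using γ.2 W' (hV.trans h) i j hi hj⟩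
  res_id V γ := Subtype.ext <| funext fun _ => G.res_id _ _
  res_comp h₁ h₂ γ := Subtype.ext <| funext fun _ => G.res_comp _ _ _
  glue {κ} V s hs := by
    have hcov (i) : iSup V ⊓ c.U i ≤ ⨆ a, V a ⊓ c.U i := (iSup_inf_eq V (c.U i)).le
    have hsub (i a) : V a ⊓ c.U i ≤ iSup V ⊓ c.U i := inf_le_inf_right _ (le_iSup V a)
    have hex : ∀ i, ∃ t : G.secs (iSup V ⊓ c.U i), ∀ a, G.res (hsub i a) t = (s a).1 i :=
      fun i => G.exists_glue (hsub i) (hcov i) (fun a => (s a).1 i) fun a b => by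
        have h := congrArg (fun γ => G.res (le_inf (inf_le_inf inf_le_left inf_le_left)
          (inf_le_left.trans inf_le_right) : V a ⊓ c.U i ⊓ (V b ⊓ c.U i) ≤ V a ⊓ V b ⊓ c.U i)
          (γ.1 i)) (hs a b)
        simpa only [G.res_comp] using h
    choose t ht using hex
    refine ⟨⟨t, fun W hW i j hi hj => ?_⟩, fun a => Subtype.ext <| funext fun i => ht i a,
      fun t' ht' => Subtype.ext <| funext fun i => ?_⟩
    · refine G.ext_of_cover (U := fun a => W ⊓ V a) (fun a => inf_le_left)
        ((le_inf le_rfl hW).trans (inf_iSup_eq W V).le) fun a => ?_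
      have h := (s a).2 (W ⊓ V a) inf_le_right i j (inf_le_left.trans hi) (inf_le_left.trans hj)
      rw [← ht, ← ht] at h
      simpa only [G.res_mul, G.res_comp] using h
    · exact G.ext_of_cover (hsub i) (hcov i) fun a =>
        (congrFun (congrArg Subtype.val (ht' a)) i).trans (ht i a).symm

theorem exists_section_image {V : Opens X} (γ : c.TorsorSections V) :
    ∃ e : E.secs V, ∀ i, E.res (inf_le_left : V ⊓ c.U i ≤ V) e =
      ρ.act _ (γ.1 i) (E.res inf_le_right (c.c.e i)) := by
  refine E.exists_glue (fun i => inf_le_left) (le_iSup_inf_of_covers c.covers V) _ fun i j => ?_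
  have hi : V ⊓ c.U i ⊓ (V ⊓ c.U j) ≤ c.U i := inf_le_left.trans inf_le_right
  have hj : V ⊓ c.U i ⊓ (V ⊓ c.U j) ≤ c.U j := inf_le_right.trans inf_le_right
  simp only [ρ.act_res, E.res_comp]
  rw [c.res_e hi hj, ← ρ.act_mul, γ.2 _ (inf_le_left.trans inf_le_left) i j hi hj]

/-- The image in `E` of a section of the torsor glued from `c`. -/
def sectionImage {V : Opens X} (γ : c.TorsorSections V) : E.secs V :=
  (c.exists_section_image γ).choose

theorem eq_sectionImage {V : Opens X} (γ : c.TorsorSections V) {e : E.secs V}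
    (he : ∀ i, E.res (inf_le_left : V ⊓ c.U i ≤ V) e =
      ρ.act _ (γ.1 i) (E.res inf_le_right (c.c.e i))) : e = c.sectionImage γ :=
  E.ext_of_cover (fun _ => inf_le_left) (le_iSup_inf_of_covers c.covers V) fun i =>
    (he i).trans ((c.exists_section_image γ).choose_spec i).symm

theorem res_sectionImage {V : Opens X} (γ : c.TorsorSections V) (i : c.ι) :
    E.res (inf_le_left : V ⊓ c.U i ≤ V) (c.sectionImage γ) =
      ρ.act _ (γ.1 i) (E.res inf_le_right (c.c.e i)) :=
  (c.exists_section_image γ).choose_spec i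

/-- The trivialization over `U i` of the torsor glued from `c`. -/
def trivialization (i : c.ι) (V : Opens X) (hV : V ≤ c.U i) :
    c.TorsorSections V ≃ G.secs V where
  toFun γ := G.res (le_inf le_rfl hV) (γ.1 i)
  invFun g := ⟨fun j => G.res inf_le_left g * G.res (inf_le_inf_right _ hV) (c.c.g i j),
    fun W hW j k hj hk => by
      simp only [G.res_mul, G.res_comp, mul_assoc]
      rw [c.res_g_mul_res_g (hW.trans hV) hj hk]⟩
  left_inv γ := Subtype.ext <| funext fun j => by
    have h := γ.2 (V ⊓ c.U j) inf_le_left i j (inf_le_left.trans hV) inf_le_right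
    rw [G.res_id] at h
    simp only [G.res_comp]
    exact h.symm
  right_inv g := by
    simp only [G.res_comp, G.res_id, c.isCocycle.1, G.res_one, mul_one]

/-- The torsor pair glued from the cocycle `c`. -/
def torsorPair : TorsorPair G E ρ where
  P := c.torsorSheaf
  act V g γ := ⟨fun i => G.res inf_le_left g * γ.1 i, fun W hW i j hi hj => by
    simp only [G.res_mul, G.res_comp, mul_assoc]
    rw [γ.2 W hW i j hi hj]⟩
  act_one V γ := Subtype.ext <| funext fun i => by simp only [G.res_one, one_mul]
  act_mul V g g' γ := Subtype.ext <| funext fun i => by simp only [G.res_mul, mul_assoc]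
  act_res h g γ := Subtype.ext <| funext fun i => by
    simp only [torsorSheaf, G.res_mul, G.res_comp]
  locally_trivial x := by
    obtain ⟨i, hi⟩ := Opens.mem_iSup.1 (c.covers.ge (Opens.mem_top x))
    refine ⟨c.U i, hi, c.trivialization i, fun V hV g γ => ?_, fun V V' hV h γ => ?_⟩
    · exact (G.res_mul _ _ _).trans
        (congrArg (· * _) ((G.res_comp _ _ g).trans (G.res_id _ g)))
    · exact (G.res_comp _ _ _).trans (G.res_comp _ _ _).symm
  η V γ := c.sectionImage γ
  η_res {W V} h γ := c.eq_sectionImage _ fun i => by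
    have h' := congrArg (E.res (inf_le_inf_right _ h : W ⊓ c.U i ≤ V ⊓ c.U i))
      (c.res_sectionImage γ i)
    simpa only [torsorSheaf, ρ.act_res, E.res_comp] using h'
  η_equiv V g γ := .symm <| c.eq_sectionImage _ fun i =>
    ((ρ.act_res _ _ _).trans (congrArg _ (c.res_sectionImage γ i))).trans (ρ.act_mul _ _ _ _).symm

theorem torsorPair_isDescribedBy : c.torsorPair.IsDescribedBy c.c := by
  refine ⟨fun i => ⟨c.c.g i, fun W hW j k hj hk => (c.res_g_mul_res_g hW hj hk).symm⟩,
    fun i j => Subtype.ext <| funext fun k => ?_,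
    fun i => (c.eq_sectionImage _ (c.isCocycle.2.2.2 i)).symm⟩
  exact (c.res_g_mul_res_g (W := c.U i ⊓ c.U j ⊓ c.U k) (inf_le_left.trans inf_le_left)
    (inf_le_left.trans inf_le_right) inf_le_right).symm

end GlobalCocycle

theorem TorsorPair.IsDescribedBy.pairRel_of_cechRel {T T' : TorsorPair G E ρ}
    {c c' : GlobalCocycle G E ρ} (hc : T.IsDescribedBy c.c) (hc' : T'.IsDescribedBy c'.c)
    (h : CechRel ρ c c') : PairRel T T' := by
  obtain ⟨κ, W, hW, a, b, ha, hb, h⟩ := h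
  exact ((hc.restrict W a ha).of_cohomologous h).pairRel hW (hc'.restrict W b hb)

end NCGeom

open NCGeom in
/-- Let `X` be a topological space, `G` a sheaf of groups on `X` and `E`
a sheaf of sets with a `G`-action.  Then the nonabelian hypercohomology set
`ℍ¹(X, G ⟳ E)` is in bijection with the set of isomorphism classes of pairs `(P, e)` of a
`G`-torsor `P` on `X` and a global section `e` of the twisted sheaf `E_P = P ×_G E`
(encoded as a `G`-equivariant morphism `P → E`). -/
theorem H1_classifies_torsor_pairs (X : Type) [TopologicalSpace X]
    (G : SheafOfGroups X) (E : SetSheaf X) (ρ : ActionOn G E) :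
    Nonempty (H1 ρ ≃ Quot (PairRel (G := G) (E := E) (ρ := ρ))) := by
  choose κ hκ using TorsorPair.exists_isDescribedBy (G := G) (E := E) (ρ := ρ)
  have hτ := GlobalCocycle.torsorPair_isDescribedBy (G := G) (E := E) (ρ := ρ)
  refine ⟨⟨Quot.map GlobalCocycle.torsorPair fun c c' h => (hτ c).pairRel_of_cechRel (hτ c') h,
    Quot.map κ fun T T' h => ((hκ T).of_pairRel h).cechRel (hκ T'), ?_, ?_⟩⟩
  · rintro ⟨c⟩
    exact Quot.sound ((hκ _).cechRel (hτ c))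
  · rintro ⟨T⟩
    exact Quot.sound ((hτ _).pairRel (κ T).covers (hκ T))
end
end
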